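/- Let d ≥ 1 and j ∈ {1,…,d}, and let R_j denote the j-th Riesz transform. Fix 1 < p < 2 and ε > 0, and set c_p = (32/π)^{1/2} · p^{(3−p)/2} / ((p−1)^{(4−p)/2} (2−p)^{1/2}). If f : ℝ^d → ℂ is a Schwartz function satisfying ‖R_j f‖_{L^p(ℝ^d)} ≥ (tan(π/(2p)) − ε)·‖f‖_{L^p(ℝ^d)}, then ‖ |R_j f| − tan(π/(2p))·|f| ‖_{L^p(ℝ^d)} ≤ c_p · ε^{1/2} · ‖f‖_{L^p(ℝ^d)}. -/

import Mathlib

open MeasureTheory FourierTransform Real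

/-- The angular form of the sharp conjugate-function inequality, with a remainder. -/
lemma angular_inequality {p k t b θ₀ : ℝ} (hp1 : 1 < p) (hp2 : p < 2)
    (hθ₀ : θ₀ = π / (2 * p)) (ht : t = tan θ₀) (hb : b = sin θ₀ ^ (p - 1) / cos θ₀)
    (hk0 : k ≤ t ^ p - b)
    (hk : k * p ≤ (p - 1) * (t ^ p * cos θ₀ ^ (p - 2) - sin θ₀ ^ (p - 2)))
    {θ : ℝ} (hθ : θ ∈ Set.Icc 0 (π / 2)) :
    sin θ ^ p + k * (1 - sin (p * θ)) ≤ t ^ p * cos θ ^ p - b * cos (p * θ) := by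
  have hπ := pi_pos
  have hpθ₀ : p * θ₀ = π / 2 := by rw [hθ₀]; field_simp
  have hθ₀0 : 0 < θ₀ := by rw [hθ₀]; positivity
  have hθ₀2 : θ₀ < π / 2 := by nlinarith
  have hc0 : 0 < cos θ₀ := cos_pos_of_mem_Ioo ⟨by linarith, hθ₀2⟩
  have hs0 : 0 < sin θ₀ := sin_pos_of_pos_of_lt_pi hθ₀0 (by linarith)
  have htp : t ^ p * cos θ₀ ^ p = sin θ₀ ^ p := by
    rw [ht, tan_eq_sin_div_cos, ← mul_rpow (by positivity) hc0.le, div_mul_cancel₀ _ hc0.ne']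
  have ht0 : 0 < t := by rw [ht, tan_eq_sin_div_cos]; positivity
  have hcos : ∀ x ∈ Set.Ioo 0 (π / 2), 0 < cos x := fun x hx =>
    cos_pos_of_mem_Ioo ⟨by linarith [hx.1], hx.2⟩
  have hsin : ∀ x ∈ Set.Ioo 0 (π / 2), 0 < sin x := fun x hx =>
    sin_pos_of_pos_of_lt_pi hx.1 (by linarith [hx.2])
  have hsinp : ∀ x ∈ Set.Ioo 0 (π / 2), 0 < sin (p * x) := fun x hx =>
    sin_pos_of_pos_of_lt_pi (mul_pos (by linarith) hx.1) (by nlinarith [hx.1, hx.2])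
  set n : ℝ → ℝ := fun x => b + k * cos (p * x) - t ^ p * (cos x ^ (p - 1) * cos ((p - 1) * x))
    - sin x ^ (p - 1) * sin ((p - 1) * x) with hn
  set s : ℝ → ℝ := fun x => (p - 1) * (t ^ p * cos x ^ (p - 2) - sin x ^ (p - 2)) - k * p with hs
  have hncont : Continuous n := by
    have h1 : Continuous fun x : ℝ => cos x ^ (p - 1) :=
      continuous_cos.rpow_const (fun _ => Or.inr (by linarith))
    have h2 : Continuous fun x : ℝ => sin x ^ (p - 1) :=
      continuous_sin.rpow_const (fun _ => Or.inr (by linarith))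
    simp only [hn]; fun_prop
  have hnderiv : ∀ x ∈ Set.Ioo 0 (π / 2), HasDerivAt n (sin (p * x) * s x) x := by
    intro x hx
    have hc := hcos x hx
    have hs' := hsin x hx
    have h1 : HasDerivAt (fun x : ℝ => cos (p * x)) (-sin (p * x) * p) x := by
      simpa using ((hasDerivAt_id x).const_mul p).cos
    have h2 : HasDerivAt (fun x : ℝ => cos ((p - 1) * x)) (-sin ((p - 1) * x) * (p - 1)) x := by
      simpa using ((hasDerivAt_id x).const_mul (p - 1)).cos
    have h3 : HasDerivAt (fun x : ℝ => sin ((p - 1) * x)) (cos ((p - 1) * x) * (p - 1)) x := by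
      simpa using ((hasDerivAt_id x).const_mul (p - 1)).sin
    have h4 := (hasDerivAt_cos x).rpow_const (p := p - 1) (Or.inl hc.ne')
    have h5 := (hasDerivAt_sin x).rpow_const (p := p - 1) (Or.inl hs'.ne')
    have h := (((h1.const_mul k).const_add b).sub ((h4.mul h2).const_mul (t ^ p))).sub (h5.mul h3)
    refine h.congr_deriv ?_
    have e1 : cos x ^ (p - 1) = cos x ^ (p - 2) * cos x := by
      rw [← rpow_add_one hc.ne']; ring_nf
    have e2 : sin x ^ (p - 1) = sin x ^ (p - 2) * sin x := by
      rw [← rpow_add_one hs'.ne']; ring_nf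
    have e3 : p - 1 - 1 = p - 2 := by ring
    have e4 : sin (p * x) = sin ((p - 1) * x) * cos x + cos ((p - 1) * x) * sin x := by
      rw [← sin_add]; ring_nf
    simp only [hs, e1, e2, e3]
    rw [e4]; ring
  have hsmono : ∀ x ∈ Set.Ioo 0 (π / 2), ∀ y ∈ Set.Ioo 0 (π / 2), x ≤ y → s x ≤ s y := by
    intro x hx y hy hxy
    have h1 : cos y ≤ cos x := cos_le_cos_of_nonneg_of_le_pi hx.1.le (by linarith [hy.2]) hxy
    have h2 : sin x ≤ sin y := sin_le_sin_of_le_of_le_pi_div_two (by linarith [hx.1]) hy.2.le hxy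
    have h3 := rpow_le_rpow_of_nonpos (hcos y hy) h1 (by linarith : p - 2 ≤ 0)
    have h4 := rpow_le_rpow_of_nonpos (hsin x hx) h2 (by linarith : p - 2 ≤ 0)
    have h5 : 0 ≤ t ^ p := by positivity
    simp only [hs]
    have := mul_le_mul_of_nonneg_left h3 h5
    nlinarith
  have hsθ₀ : 0 ≤ s θ₀ := by simp only [hs]; linarith
  have hθ₀m : θ₀ ∈ Set.Ioo 0 (π / 2) := ⟨hθ₀0, hθ₀2⟩
  have hnθ₀ : n θ₀ = 0 := by
    have e1 : (p - 1) * θ₀ = π / 2 - θ₀ := by linarith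
    have e2 : t ^ p * cos θ₀ ^ (p - 1) = sin θ₀ ^ p / cos θ₀ := by
      rw [rpow_sub_one hc0.ne', ← htp]; ring
    have e3 : sin θ₀ ^ p = sin θ₀ ^ (p - 1) * sin θ₀ := by
      rw [← rpow_add_one hs0.ne']; ring_nf
    simp only [hn, hpθ₀, e1, cos_pi_div_two, cos_pi_div_two_sub, sin_pi_div_two_sub]
    rw [← mul_assoc, e2, e3, hb]
    field_simp
    linear_combination -(sin θ₀ ^ (p - 1)) * sin_sq_add_cos_sq θ₀
  have hn0 : n 0 ≤ 0 := by
    have : (0:ℝ) ^ (p - 1) = 0 := zero_rpow (by linarith)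
    simp [hn, this]; linarith
  have hnpos : ∀ x ∈ Set.Ico θ₀ (π / 2), 0 ≤ n x := by
    intro x hx
    have : MonotoneOn n (Set.Icc θ₀ x) := by
      refine monotoneOn_of_hasDerivWithinAt_nonneg (convex_Icc _ _) hncont.continuousOn
        (f' := fun y => sin (p * y) * s y) ?_ ?_
      all_goals
        intro y hy; rw [interior_Icc] at hy
        have hy' : y ∈ Set.Ioo 0 (π / 2) := ⟨hθ₀0.trans hy.1, hy.2.trans hx.2⟩
      · exact (hnderiv y hy').hasDerivWithinAt
      · exact mul_nonneg (hsinp y hy').le (hsθ₀.trans (hsmono _ hθ₀m _ hy' hy.1.le))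
    rw [← hnθ₀]
    exact this ⟨le_rfl, hx.1⟩ ⟨hx.1, le_rfl⟩ hx.1
  have hnneg : ∀ x ∈ Set.Ioc 0 θ₀, n x ≤ 0 := by
    intro x hx
    have hxm : x ∈ Set.Ioo 0 (π / 2) := ⟨hx.1, hx.2.trans_lt hθ₀2⟩
    rcases le_total 0 (s x) with h | h
    · have : MonotoneOn n (Set.Icc x θ₀) := by
        refine monotoneOn_of_hasDerivWithinAt_nonneg (convex_Icc _ _) hncont.continuousOn
          (f' := fun y => sin (p * y) * s y) ?_ ?_
        all_goals
          intro y hy; rw [interior_Icc] at hy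
          have hy' : y ∈ Set.Ioo 0 (π / 2) := ⟨hx.1.trans hy.1, hy.2.trans hθ₀2⟩
        · exact (hnderiv y hy').hasDerivWithinAt
        · exact mul_nonneg (hsinp y hy').le (h.trans (hsmono _ hxm _ hy' hy.1.le))
      rw [← hnθ₀]
      exact this ⟨le_rfl, hx.2⟩ ⟨hx.2, le_rfl⟩ hx.2
    · have : AntitoneOn n (Set.Icc 0 x) := by
        refine antitoneOn_of_hasDerivWithinAt_nonpos (convex_Icc _ _) hncont.continuousOn
          (f' := fun y => sin (p * y) * s y) ?_ ?_
        all_goals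
          intro y hy; rw [interior_Icc] at hy
          have hy' : y ∈ Set.Ioo 0 (π / 2) := ⟨hy.1, hy.2.trans hxm.2⟩
        · exact (hnderiv y hy').hasDerivWithinAt
        · exact mul_nonpos_of_nonneg_of_nonpos (hsinp y hy').le
            ((hsmono _ hy' _ hxm hy.2.le).trans h)
      exact (this ⟨le_rfl, hx.1.le⟩ ⟨hx.1.le, le_rfl⟩ hx.1.le).trans hn0
  set D : ℝ → ℝ := fun x => t ^ p * cos x ^ p - sin x ^ p - b * cos (p * x)
    - k * (1 - sin (p * x)) with hD
  have hDcont : Continuous D := by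
    have h1 : Continuous fun x : ℝ => cos x ^ p :=
      continuous_cos.rpow_const (fun _ => Or.inr (by linarith))
    have h2 : Continuous fun x : ℝ => sin x ^ p :=
      continuous_sin.rpow_const (fun _ => Or.inr (by linarith))
    simp only [hD]; fun_prop
  have hDθ₀ : D θ₀ = 0 := by simp [hD, hpθ₀, htp]
  have hqderiv : ∀ x ∈ Set.Ioo 0 (π / 2),
      HasDerivAt (fun y => D y / sin (p * y)) (p * n x / sin (p * x) ^ 2) x := by
    intro x hx
    have hc := hcos x hx
    have hs' := hsin x hx
    have h1 : HasDerivAt (fun x : ℝ => cos (p * x)) (-sin (p * x) * p) x := by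
      simpa using ((hasDerivAt_id x).const_mul p).cos
    have h2 : HasDerivAt (fun x : ℝ => sin (p * x)) (cos (p * x) * p) x := by
      simpa using ((hasDerivAt_id x).const_mul p).sin
    have h4 := (hasDerivAt_cos x).rpow_const (p := p) (Or.inl hc.ne')
    have h5 := (hasDerivAt_sin x).rpow_const (p := p) (Or.inl hs'.ne')
    have h := ((((h4.const_mul (t ^ p)).sub h5).sub (h1.const_mul b)).sub
      ((h2.const_sub 1).const_mul k)).div h2 (hsinp x hx).ne'
    refine h.congr_deriv ?_
    have e1 : cos x ^ p = cos x ^ (p - 1) * cos x := by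
      rw [← rpow_add_one hc.ne']; ring_nf
    have e2 : sin x ^ p = sin x ^ (p - 1) * sin x := by
      rw [← rpow_add_one hs'.ne']; ring_nf
    have e4 : sin ((p - 1) * x) = sin (p * x) * cos x - cos (p * x) * sin x := by
      rw [← sin_sub]; ring_nf
    have e5 : cos ((p - 1) * x) = cos (p * x) * cos x + sin (p * x) * sin x := by
      rw [← cos_sub]; ring_nf
    congr 1
    simp only [hn, e1, e2, e4, e5, Pi.sub_apply]
    linear_combination (b * p) * sin_sq_add_cos_sq (p * x)
  have hDpos : ∀ x ∈ Set.Ioo 0 (π / 2), 0 ≤ D x := by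
    intro x hx
    have hq : 0 ≤ D x / sin (p * x) := by
      have hcont : ContinuousOn (fun y => D y / sin (p * y)) (Set.Ioo 0 (π / 2)) := fun y hy =>
        (hqderiv y hy).continuousAt.continuousWithinAt
      rcases le_total x θ₀ with h | h
      · have hsub : Set.Icc x θ₀ ⊆ Set.Ioo 0 (π / 2) := fun y hy =>
          ⟨hx.1.trans_le hy.1, hy.2.trans_lt hθ₀2⟩
        have : AntitoneOn (fun y => D y / sin (p * y)) (Set.Icc x θ₀) := by
          refine antitoneOn_of_hasDerivWithinAt_nonpos (convex_Icc _ _) (hcont.mono hsub)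
            (f' := fun y => p * n y / sin (p * y) ^ 2) ?_ ?_
          · intro y hy
            exact (hqderiv y (hsub (interior_subset hy))).hasDerivWithinAt
          · intro y hy
            have hy' := interior_subset hy
            exact div_nonpos_of_nonpos_of_nonneg (mul_nonpos_of_nonneg_of_nonpos (by linarith)
              (hnneg y ⟨hx.1.trans_le hy'.1, hy'.2⟩)) (sq_nonneg _)
        have h' := this ⟨le_rfl, h⟩ ⟨h, le_rfl⟩ h
        simpa [hDθ₀] using h'
      · have hsub : Set.Icc θ₀ x ⊆ Set.Ioo 0 (π / 2) := fun y hy =>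
          ⟨hθ₀0.trans_le hy.1, hy.2.trans_lt hx.2⟩
        have : MonotoneOn (fun y => D y / sin (p * y)) (Set.Icc θ₀ x) := by
          refine monotoneOn_of_hasDerivWithinAt_nonneg (convex_Icc _ _) (hcont.mono hsub)
            (f' := fun y => p * n y / sin (p * y) ^ 2) ?_ ?_
          · intro y hy
            exact (hqderiv y (hsub (interior_subset hy))).hasDerivWithinAt
          · intro y hy
            have hy' := interior_subset hy
            exact div_nonneg (mul_nonneg (by linarith)
              (hnpos y ⟨hy'.1, hy'.2.trans_lt hx.2⟩)) (sq_nonneg _)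
        have h' := this ⟨le_rfl, h⟩ ⟨h, le_rfl⟩ h
        simpa [hDθ₀] using h'
    have := mul_nonneg hq (hsinp x hx).le
    rwa [div_mul_cancel₀ _ (hsinp x hx).ne'] at this
  have hclos : θ ∈ closure (Set.Ioo 0 (π / 2)) := by
    rw [closure_Ioo (by positivity)]; exact hθ
  have : 0 ≤ D θ := by
    have hcl : IsClosed {x | 0 ≤ D x} := isClosed_le continuous_const hDcont
    exact hcl.closure_subset_iff.2 hDpos hclos
  simp only [hD] at this
  linarith

/-- The subharmonic function `Re (|u| + i v) ^ p` of `u + i v`. -/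
noncomputable def foldedPow (p : ℝ) (w : ℂ) : ℝ := ((⟨|w.re|, w.im⟩ : ℂ) ^ (p : ℂ)).re

lemma exists_polar_foldedPow {p : ℝ} (hp : 0 < p) (w : ℂ) : ∃ θ ∈ Set.Icc 0 (π / 2),
    |w.re| = ‖w‖ * cos θ ∧ |w.im| = ‖w‖ * sin θ ∧ foldedPow p w = ‖w‖ ^ p * cos (p * θ) := by
  set w' : ℂ := ⟨|w.re|, w.im⟩ with hw'
  have hnorm : ‖w'‖ = ‖w‖ := by
    rw [Complex.norm_def, Complex.norm_def, Complex.normSq_apply, Complex.normSq_apply]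
    simp [hw', abs_mul_abs_self]
  have harg : |w'.arg| ≤ π / 2 := Complex.abs_arg_le_pi_div_two_iff.2 (abs_nonneg _)
  refine ⟨|w'.arg|, ⟨abs_nonneg _, harg⟩, ?_, ?_, ?_⟩
  · rw [cos_abs, ← hnorm, Complex.norm_mul_cos_arg]
  · have h : |‖w'‖ * sin w'.arg| = |w.im| := by rw [Complex.norm_mul_sin_arg]
    rw [← h, abs_mul, abs_of_nonneg (norm_nonneg w'), hnorm,
      abs_sin_eq_sin_abs_of_abs_le_pi (by linarith [pi_pos])]
  · rw [foldedPow, Complex.cpow_ofReal_re, hnorm]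
    rw [mul_comm w'.arg, ← cos_abs (p * _), abs_mul, abs_of_pos hp]

lemma abs_foldedPow_le {p : ℝ} (hp : 0 < p) (w : ℂ) : |foldedPow p w| ≤ ‖w‖ ^ p := by
  obtain ⟨θ, -, -, -, h⟩ := exists_polar_foldedPow hp w
  rw [h, abs_mul, abs_of_nonneg (by positivity)]
  exact mul_le_of_le_one_right (by positivity) (abs_cos_le_one _)

lemma one_sub_sin_mul_ge {p θ θ₀ : ℝ} (hp1 : 1 < p) (hp2 : p < 2) (hθ₀ : θ₀ = π / (2 * p))
    (hθ : θ ∈ Set.Icc 0 (π / 2)) :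
    p ^ 2 / 2 * cos θ₀ ^ 2 * (sin θ - tan θ₀ * cos θ) ^ 2 ≤ 1 - sin (p * θ) := by
  have hπ := pi_pos
  have hpθ₀ : p * θ₀ = π / 2 := by rw [hθ₀]; field_simp
  have hθ₀0 : 0 < θ₀ := by rw [hθ₀]; positivity
  have hθ₀2 : θ₀ < π / 2 := by nlinarith
  have hc0 : 0 < cos θ₀ := cos_pos_of_mem_Ioo ⟨by linarith, hθ₀2⟩
  have key : ∀ ψ ∈ Set.Icc 0 (π / 2), p / 2 * sin ψ ≤ sin (p / 2 * ψ) := by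
    intro ψ hψ
    have := strictConcaveOn_sin_Icc.concaveOn.2 (show ψ ∈ Set.Icc 0 π from
      ⟨hψ.1, by linarith [hψ.2]⟩) (show (0 : ℝ) ∈ Set.Icc 0 π from ⟨le_rfl, hπ.le⟩)
      (show 0 ≤ p / 2 by linarith) (show 0 ≤ 1 - p / 2 by linarith) (by ring)
    simpa using this
  have key2 : (p / 2) ^ 2 * sin (θ - θ₀) ^ 2 ≤ sin (p / 2 * (θ - θ₀)) ^ 2 := by
    rcases le_total θ₀ θ with h | h
    · have h1 := key (θ - θ₀) ⟨by linarith, by linarith [hθ.2]⟩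
      have h2 : 0 ≤ sin (θ - θ₀) := sin_nonneg_of_nonneg_of_le_pi (by linarith) (by linarith [hθ.2])
      rw [← mul_pow]; gcongr
    · have h1 := key (θ₀ - θ) ⟨by linarith, by linarith [hθ.1]⟩
      have h2 : 0 ≤ sin (θ₀ - θ) := sin_nonneg_of_nonneg_of_le_pi (by linarith) (by linarith [hθ.1])
      have e1 : sin (θ - θ₀) = - sin (θ₀ - θ) := by rw [← sin_neg]; ring_nf
      have e2 : sin (p / 2 * (θ - θ₀)) = - sin (p / 2 * (θ₀ - θ)) := by rw [← sin_neg]; ring_nf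
      rw [e1, e2, neg_sq, neg_sq, ← mul_pow]; gcongr
  have e1 : cos θ₀ * (sin θ - tan θ₀ * cos θ) = sin (θ - θ₀) := by
    rw [tan_eq_sin_div_cos, sin_sub]; field_simp
  have e2 : 1 - sin (p * θ) = 2 * sin (p / 2 * (θ - θ₀)) ^ 2 := by
    have h1 : sin (p * θ) = cos (2 * (p / 2 * (θ - θ₀))) := by
      rw [← cos_pi_div_two_sub, ← cos_neg, ← hpθ₀]; ring_nf
    rw [h1, cos_two_mul, cos_sq']; ring
  rw [e2]
  calc _ = 2 * ((p / 2) ^ 2 * (cos θ₀ * (sin θ - tan θ₀ * cos θ)) ^ 2) := by ring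
    _ ≤ _ := by rw [e1]; linarith

lemma foldedPow_inequality {p k t b θ₀ : ℝ} (hp1 : 1 < p) (hp2 : p < 2)
    (hθ₀ : θ₀ = π / (2 * p)) (ht : t = tan θ₀) (hb : b = sin θ₀ ^ (p - 1) / cos θ₀)
    (hk00 : 0 ≤ k) (hk0 : k ≤ t ^ p - b)
    (hk : k * p ≤ (p - 1) * (t ^ p * cos θ₀ ^ (p - 2) - sin θ₀ ^ (p - 2))) (w : ℂ) :
    |w.im| ^ p + k * p ^ 2 / 2 * cos θ₀ ^ 2 * (‖w‖ ^ (p - 2) * (|w.im| - t * |w.re|) ^ 2)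
      ≤ t ^ p * |w.re| ^ p - b * foldedPow p w := by
  have hp0 : 0 < p := by linarith
  obtain ⟨θ, hθ, hre, him, hΦ⟩ := exists_polar_foldedPow hp0 w
  rw [hre, him, hΦ]
  rcases (norm_nonneg w).eq_or_lt with h0 | h0
  · rw [← h0]; simp [zero_rpow hp0.ne']
  have h1 := angular_inequality hp1 hp2 hθ₀ ht hb hk0 hk hθ
  have h2 := one_sub_sin_mul_ge hp1 hp2 hθ₀ hθ
  rw [← ht] at h2
  have h3 := mul_le_mul_of_nonneg_left h2 hk00
  have hs : 0 ≤ sin θ := sin_nonneg_of_nonneg_of_le_pi hθ.1 (by linarith [hθ.2, pi_pos])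
  have hc : 0 ≤ cos θ := cos_nonneg_of_mem_Icc ⟨by linarith [hθ.1, pi_pos], hθ.2⟩
  rw [mul_rpow h0.le hs, mul_rpow h0.le hc]
  have e : ‖w‖ ^ p = ‖w‖ ^ (p - 2) * ‖w‖ ^ 2 := by
    rw [← rpow_add_natCast h0.ne']; norm_num
  have h4 := mul_le_mul_of_nonneg_left (add_le_of_add_le_left h1 h3) (by positivity : 0 ≤ ‖w‖ ^ p)
  calc _ = ‖w‖ ^ p * (sin θ ^ p + k * (p ^ 2 / 2 * cos θ₀ ^ 2 * (sin θ - t * cos θ) ^ 2)) := by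
        rw [e]; ring
    _ ≤ _ := h4
    _ = _ := by ring

lemma tan_le_four_div_pi_mul {x : ℝ} (h0 : 0 ≤ x) (h1 : x ≤ π / 4) : tan x ≤ 4 / π * x := by
  have hπ := pi_pos
  have hcos : ∀ y ∈ Set.Icc 0 (π / 4), 0 < cos y := fun y hy =>
    cos_pos_of_mem_Ioo ⟨by linarith [hy.1], by linarith [hy.2]⟩
  have hconv : ConvexOn ℝ (Set.Icc 0 (π / 4)) tan := by
    refine MonotoneOn.convexOn_of_deriv (convex_Icc _ _) ?_ ?_ ?_
    · intro y hy
      exact (hasDerivAt_tan (hcos y hy).ne').continuousAt.continuousWithinAt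
    · intro y hy
      exact (hasDerivAt_tan
        (hcos y (interior_subset hy)).ne').differentiableAt.differentiableWithinAt
    · intro y hy z hz hyz
      have hy' := interior_subset hy
      have hz' := interior_subset hz
      have := hcos z hz'
      have h : cos z ≤ cos y := cos_le_cos_of_nonneg_of_le_pi hy'.1 (by linarith [hz'.2]) hyz
      rw [deriv_tan, deriv_tan]
      gcongr
  have := hconv.2 (show π / 4 ∈ Set.Icc 0 (π / 4) from ⟨by positivity, le_rfl⟩)
    (show (0 : ℝ) ∈ Set.Icc 0 (π / 4) from ⟨le_rfl, by positivity⟩)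
    (show 0 ≤ 4 / π * x by positivity)
    (show 0 ≤ 1 - 4 / π * x by
      have : 4 / π * x ≤ 4 / π * (π / 4) := by gcongr
      have e : 4 / π * (π / 4) = 1 := by field_simp
      linarith) (by ring)
  simp only [smul_eq_mul, mul_zero, add_zero, tan_pi_div_four, tan_zero, mul_one] at this
  have e : 4 / π * x * (π / 4) = x := by field_simp
  rwa [e] at this

lemma tan_pi_div_eq_inv {p : ℝ} (hp1 : 1 < p) :
    tan (π / (2 * p)) = (tan (π * (p - 1) / (2 * p)))⁻¹ := by
  rw [← tan_pi_div_two_sub]; congr 1; field_simp; ring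

lemma le_tan_pi_div {p : ℝ} (hp1 : 1 < p) (hp2 : p < 2) :
    p / (2 * (p - 1)) ≤ tan (π / (2 * p)) := by
  have hπ := pi_pos
  have hp : 0 < p - 1 := by linarith
  have h0 : 0 < π * (p - 1) / (2 * p) := by positivity
  have h1 : π * (p - 1) / (2 * p) ≤ π / 4 := by
    rw [div_le_div_iff₀ (by positivity) (by positivity)]; nlinarith
  have h2 := tan_le_four_div_pi_mul h0.le h1
  rw [tan_pi_div_eq_inv hp1]
  have h3 : 0 < tan (π * (p - 1) / (2 * p)) := tan_pos_of_pos_of_lt_pi_div_two h0 (by linarith)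
  rw [le_inv_comm₀ (by positivity) h3]
  refine h2.trans (le_of_eq ?_)
  field_simp; norm_num

lemma tan_pi_div_le {p : ℝ} (hp1 : 1 < p) (hp2 : p < 2) :
    tan (π / (2 * p)) ≤ 2 * p / (π * (p - 1)) := by
  have hπ := pi_pos
  have hp : 0 < p - 1 := by linarith
  have h0 : 0 < π * (p - 1) / (2 * p) := by positivity
  have h1 : π * (p - 1) / (2 * p) ≤ π / 4 := by
    rw [div_le_div_iff₀ (by positivity) (by positivity)]; nlinarith
  rw [tan_pi_div_eq_inv hp1, inv_le_comm₀ (lt_of_lt_of_le h0 (le_tan h0.le (by linarith)))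
    (by positivity)]
  rw [inv_div]
  exact le_tan h0.le (by linarith)

lemma le_tan_pi_div' {p : ℝ} (hp1 : 1 < p) (hp2 : p < 2) :
    (4 * p + π * (2 - p)) / (4 * p - π * (2 - p)) ≤ tan (π / (2 * p)) := by
  have hπ := pi_pos
  have hπ4 := pi_le_four
  set u := π * (2 - p) / (4 * p) with hu
  have hu0 : 0 < u := by
    have : 0 < 2 - p := by linarith
    positivity
  have hu1 : u < π / 4 := by
    rw [hu, div_lt_div_iff₀ (by positivity) (by positivity)]; nlinarith
  have hpos : 0 < 4 * p - π * (2 - p) := by nlinarith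
  have e1 : tan (π / (2 * p)) = (1 + tan u) / (1 - tan u) := by
    have : π / (2 * p) = π / 4 + u := by rw [hu]; field_simp; ring
    have hcu : cos u ≠ 0 := (cos_pos_of_mem_Ioo ⟨by linarith, by linarith⟩).ne'
    rw [this, tan_eq_sin_div_cos, sin_add, cos_add, cos_pi_div_four, sin_pi_div_four,
      tan_eq_sin_div_cos u, ← mul_add, ← mul_sub, mul_div_mul_left _ _ (by positivity)]
    rw [one_add_div hcu, one_sub_div hcu, div_div_div_cancel_right₀ hcu, add_comm]
  have h1 : u ≤ tan u := le_tan hu0.le (by linarith)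
  have h2 : tan u < 1 := by
    rw [← tan_pi_div_four]
    exact tan_lt_tan_of_lt_of_lt_pi_div_two (by linarith) (by linarith) hu1
  have e2 : (4 * p + π * (2 - p)) / (4 * p - π * (2 - p)) = (1 + u) / (1 - u) := by
    rw [hu, one_add_div (by positivity), one_sub_div (by positivity),
      div_div_div_cancel_right₀ (by positivity)]
  rw [e1, e2]
  exact div_le_div₀ (by linarith) (by linarith) (by linarith) (by linarith)

lemma one_lt_tan_pi_div {p : ℝ} (hp1 : 1 < p) (hp2 : p < 2) : 1 < tan (π / (2 * p)) := by
  refine lt_of_lt_of_le ?_ (le_tan_pi_div hp1 hp2)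
  rw [one_lt_div (by linarith)]; linarith

lemma remainder_const_le_sub {p θ₀ t : ℝ} (hp1 : 1 < p) (hp2 : p < 2)
    (hθ₀ : θ₀ = π / (2 * p)) (ht : t = tan θ₀) :
    (2 - p) / 4 ≤ t ^ p - sin θ₀ ^ (p - 1) / cos θ₀ := by
  have hπ := pi_pos
  have hθ₀0 : 0 < θ₀ := by rw [hθ₀]; positivity
  have hpθ₀ : p * θ₀ = π / 2 := by rw [hθ₀]; field_simp
  have hθ₀2 : θ₀ < π / 2 := by nlinarith
  have hc0 : 0 < cos θ₀ := cos_pos_of_mem_Ioo ⟨by linarith, hθ₀2⟩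
  have hs0 : 0 < sin θ₀ := sin_pos_of_pos_of_lt_pi hθ₀0 (by linarith)
  have ht1 : 1 < t := by rw [ht, hθ₀]; exact one_lt_tan_pi_div hp1 hp2
  have ht0 : 0 < t := by linarith
  have hb : sin θ₀ ^ (p - 1) / cos θ₀ = t * sin θ₀ ^ (p - 2) := by
    have : sin θ₀ ^ (p - 1) = sin θ₀ ^ (p - 2) * sin θ₀ := by
      rw [← rpow_add_one hs0.ne']; ring_nf
    rw [this, ht, tan_eq_sin_div_cos]; ring
  have htp : t ^ p = t * t ^ (p - 1) := by
    rw [mul_comm, ← rpow_add_one ht0.ne']; ring_nf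
  have h1 : sin θ₀ ^ (p - 2) ≤ 1 + (2 - p) / 2 * (1 / t ^ 2) := by
    have e : sin θ₀ ^ (p - 2) = (1 + 1 / t ^ 2) ^ ((2 - p) / 2) := by
      have : 1 + 1 / t ^ 2 = sin θ₀ ^ (-2 : ℝ) := by
        rw [rpow_neg hs0.le, rpow_two, ht, tan_eq_sin_div_cos]
        field_simp
        linarith [sin_sq_add_cos_sq θ₀]
      rw [this, ← rpow_mul hs0.le]; ring_nf
    rw [e]
    exact rpow_one_add_le_one_add_mul_self (by linarith [show 0 < 1 / t ^ 2 by positivity])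
      (by linarith) (by linarith)
  have h2 : 1 + (p - 1) * (1 - 1 / t) ≤ t ^ (p - 1) := by
    have h3 : (1 + (1 / t - 1)) ^ (p - 1) ≤ 1 + (p - 1) * (1 / t - 1) :=
      rpow_one_add_le_one_add_mul_self (by linarith [show 0 < 1 / t by positivity])
        (by linarith) (by linarith)
    have e : (1 + (1 / t - 1)) ^ (p - 1) = (t ^ (p - 1))⁻¹ := by
      rw [← inv_rpow ht0.le]; ring_nf
    rw [e] at h3
    have h4 : 0 < t ^ (p - 1) := by positivity
    have h5 := mul_le_mul_of_nonneg_right h3 h4.le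
    rw [inv_mul_cancel₀ h4.ne'] at h5
    have h6 : 0 ≤ (p - 1) * (1 - 1 / t) := by
      have : 1 / t ≤ 1 := by rw [div_le_one ht0]; exact ht1.le
      exact mul_nonneg (by linarith) (by linarith)
    have hT : 1 ≤ t ^ (p - 1) := one_le_rpow ht1.le (by linarith)
    have h7 := mul_le_mul_of_nonneg_left hT h6
    have h8 : (1 + (p - 1) * (1 / t - 1)) * t ^ (p - 1)
        = t ^ (p - 1) - (p - 1) * (1 - 1 / t) * t ^ (p - 1) := by ring
    linarith
  have h3 : (2 - p) / 4 ≤ (p - 1) * (t - 1) - (2 - p) / (2 * t) := by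
    rcases le_total p (4 / 3) with h | h
    · have h4 := le_tan_pi_div hp1 hp2
      rw [← hθ₀, ← ht, div_le_iff₀ (by linarith)] at h4
      have h5 : 2 ≤ t := by nlinarith
      have h6 : (2 - p) / (2 * t) ≤ (2 - p) / 4 := by
        apply div_le_div_of_nonneg_left <;> linarith
      nlinarith
    · have h4 := le_tan_pi_div' hp1 hp2
      have h31 := pi_gt_d2
      have h32 := pi_lt_d2
      rw [← hθ₀, ← ht] at h4
      have hpos : 0 < 4 * p - π * (2 - p) := by nlinarith
      have hpos2 : 0 < 4 * p + π * (2 - p) := by nlinarith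
      have h6 : (2 - p) / (2 * t) ≤
          (2 - p) / 2 * ((4 * p - π * (2 - p)) / (4 * p + π * (2 - p))) := by
        have : 1 / t ≤ (4 * p - π * (2 - p)) / (4 * p + π * (2 - p)) := by
          rw [div_le_div_iff₀ ht0 hpos2]; rw [div_le_iff₀ hpos] at h4; linarith
        calc (2 - p) / (2 * t) = (2 - p) / 2 * (1 / t) := by field_simp
          _ ≤ _ := mul_le_mul_of_nonneg_left this (by linarith)
      have h7 : (2 - p) * (2 * π * (p - 1) / (4 * p - π * (2 - p))) ≤ (p - 1) * (t - 1) := by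
        have : 2 * π * (2 - p) / (4 * p - π * (2 - p)) ≤ t - 1 := by
          rw [div_le_iff₀ hpos]; rw [div_le_iff₀ hpos] at h4; linarith
        calc _ = (p - 1) * (2 * π * (2 - p) / (4 * p - π * (2 - p))) := by ring
          _ ≤ _ := mul_le_mul_of_nonneg_left this (by linarith)
      have h8 : 1 / 4 + 1 / 2 * ((4 * p - π * (2 - p)) / (4 * p + π * (2 - p)))
          ≤ 2 * π * (p - 1) / (4 * p - π * (2 - p)) := by
        have e1 : 1 / 4 + 1 / 2 * ((4 * p - π * (2 - p)) / (4 * p + π * (2 - p)))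
          = ((4 * p + π * (2 - p)) + 2 * (4 * p - π * (2 - p))) / (4 * (4 * p + π * (2 - p))) := by
          field_simp
          ring
        rw [e1, div_le_div_iff₀ (by positivity) hpos]
        nlinarith [mul_nonneg (sub_nonneg.2 h) (sub_nonneg.2 hp2.le),
          mul_nonneg (mul_nonneg (sub_nonneg.2 h) (sub_nonneg.2 hp2.le)) (sub_nonneg.2 h31.le),
          mul_nonneg (sub_nonneg.2 h31.le) (sub_nonneg.2 h32.le),
          mul_nonneg (sub_nonneg.2 h) (sub_nonneg.2 h31.le), mul_nonneg (sub_nonneg.2 h) (sub_nonneg.2 h32.le),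
          mul_nonneg (sub_nonneg.2 hp2.le) (sub_nonneg.2 h31.le),
          mul_nonneg (sub_nonneg.2 hp2.le) (sub_nonneg.2 h32.le)]
      nlinarith
  rw [hb, htp]
  have h4 := mul_le_mul_of_nonneg_left h1 ht0.le
  have h5 := mul_le_mul_of_nonneg_left h2 ht0.le
  have e1 : t * (1 + (2 - p) / 2 * (1 / t ^ 2)) = t + (2 - p) / (2 * t) := by field_simp
  have e2 : t * (1 + (p - 1) * (1 - 1 / t)) = t + (p - 1) * (t - 1) := by field_simp
  linarith

lemma remainder_const_le_mul {p θ₀ t : ℝ} (hp1 : 1 < p) (hp2 : p < 2)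
    (hθ₀ : θ₀ = π / (2 * p)) (ht : t = tan θ₀) :
    (2 - p) / 4 * p ≤ (p - 1) * (t ^ p * cos θ₀ ^ (p - 2) - sin θ₀ ^ (p - 2)) := by
  have hπ := pi_pos
  have hθ₀0 : 0 < θ₀ := by rw [hθ₀]; positivity
  have hpθ₀ : p * θ₀ = π / 2 := by rw [hθ₀]; field_simp
  have hθ₀2 : θ₀ < π / 2 := by nlinarith
  have hc0 : 0 < cos θ₀ := cos_pos_of_mem_Ioo ⟨by linarith, hθ₀2⟩
  have hs0 : 0 < sin θ₀ := sin_pos_of_pos_of_lt_pi hθ₀0 (by linarith)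
  have ht1 : 1 < t := by rw [ht, hθ₀]; exact one_lt_tan_pi_div hp1 hp2
  have e : t ^ p * cos θ₀ ^ (p - 2) = sin θ₀ ^ (p - 2) * t ^ 2 := by
    have : t ^ p = t ^ (p - 2) * t ^ 2 := by
      rw [← rpow_add_natCast (by positivity)]; norm_num
    rw [this, mul_right_comm, ← mul_rpow (by positivity) hc0.le]
    congr 2
    rw [ht, tan_eq_sin_div_cos, div_mul_cancel₀ _ hc0.ne']
  have h1 : 1 ≤ sin θ₀ ^ (p - 2) :=
    one_le_rpow_of_pos_of_le_one_of_nonpos hs0 (sin_le_one _) (by linarith)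
  have h4 := le_tan_pi_div hp1 hp2
  rw [← hθ₀, ← ht, div_le_iff₀ (by linarith)] at h4
  have h5 : 2 - p ≤ (p - 1) * (t ^ 2 - 1) := by nlinarith
  rw [e]
  nlinarith

lemma two_rpow_mul_rpow_le {p : ℝ} (hp1 : 1 < p) (hp2 : p < 2) :
    2 ^ ((2 - p) / p) * (p / (p - 1)) ^ (p - 1) ≤ π ^ 2 / 4 := by
  have hp0 : 0 < p := by linarith
  have hq : 0 < p - 1 := by linarith
  have hX : 0 < p / (p - 1) := by positivity
  have hl1 := log_two_gt_d9
  have hl2 := log_two_lt_d9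
  have hlogX : ∀ c : ℝ, 0 < c → (p - 1) * log (p / (p - 1)) ≤ p / c + (p - 1) * (log c - 1) := by
    intro c hc
    have h := log_le_sub_one_of_pos (show 0 < p / (p - 1) / c by positivity)
    rw [log_div hX.ne' hc.ne'] at h
    have := mul_le_mul_of_nonneg_left h hq.le
    have e : (p - 1) * (p / (p - 1) / c - 1) = p / c - (p - 1) := by field_simp
    rw [e] at this
    linarith
  have hα : (2 - p) / p * log 2 ≤ (2 - p) / p * 0.6932 :=
    mul_le_mul_of_nonneg_left (by linarith) (div_nonneg (by linarith) hp0.le)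
  have key : (2 - p) / p * log 2 + (p - 1) * log (p / (p - 1)) ≤ 0.9 := by
    rcases le_total p 1.1 with h | h
    · have h1 := hlogX (2 ^ 3) (by norm_num)
      rw [log_pow] at h1
      have h2 : (2 - p) / p * 0.6932 + p / 2 ^ 3 + (p - 1) * 1.08 ≤ 0.9 := by
        have : (2 - p) / p = 2 / p - 1 := by field_simp
        have h3 : 2 / p ≤ 2 - (p - 1) * (2 / 1.1) := by
          rw [div_le_iff₀ hp0]; nlinarith
        rw [this]; linarith
      push_cast at h1
      nlinarith
    · have h1 := hlogX (2 ^ 2) (by norm_num)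
      rw [log_pow] at h1
      have h2 : (2 - p) / p * 0.6932 + p / 2 ^ 2 + (p - 1) * 0.3864 ≤ 0.9 := by
        have : (2 - p) / p = 2 / p - 1 := by field_simp
        have h3 : 2 / p ≤ 2 / 1.1 - (p - 1.1) * (1 / 1.1) := by
          rw [div_le_iff₀ hp0]; nlinarith
        rw [this]; linarith
      push_cast at h1
      nlinarith
  have e : 2 ^ ((2 - p) / p) * (p / (p - 1)) ^ (p - 1)
      = exp ((2 - p) / p * log 2 + (p - 1) * log (p / (p - 1))) := by
    rw [rpow_def_of_pos two_pos, rpow_def_of_pos hX, ← exp_add]; ring_nf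
  rw [e]
  refine (exp_le_exp.2 key).trans ?_
  have h1 : exp 0.9 * exp 0.1 = exp 1 := by rw [← exp_add]; norm_num
  have h2 := quadratic_le_exp_of_nonneg (show (0:ℝ) ≤ 0.1 by norm_num)
  have h3 := exp_one_lt_d9
  have h4 := pi_gt_d2
  have h5 := exp_pos 0.9
  nlinarith

lemma stability_const_bound {p t : ℝ} (hp1 : 1 < p) (hp2 : p < 2)
    (ht : t = tan (π / (2 * p))) :
    2 * (1 + t ^ 2) * t ^ (p - 1) * (1 + t ^ p) ^ ((2 - p) / p) / ((2 - p) / 4 * p) ≤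
      32 / π * p ^ (3 - p) / ((p - 1) ^ (4 - p) * (2 - p)) := by
  have hπ := pi_pos
  have hp0 : 0 < p := by linarith
  have hq : 0 < p - 1 := by linarith
  have hr : 0 < 2 - p := by linarith
  have ht1 : 1 < t := by rw [ht]; exact one_lt_tan_pi_div hp1 hp2
  have ht0 : 0 < t := by linarith
  have htu : t ≤ 2 * p / (π * (p - 1)) := by rw [ht]; exact tan_pi_div_le hp1 hp2
  have h1 : (1 + t ^ p) ^ ((2 - p) / p) ≤ 2 ^ ((2 - p) / p) * t ^ (2 - p) := by
    have e : t ^ (2 - p) = (t ^ p) ^ ((2 - p) / p) := by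
      rw [← rpow_mul ht0.le]; congr 1; field_simp
    rw [e, ← mul_rpow (by positivity) (by positivity)]
    have : 1 ≤ t ^ p := one_le_rpow ht1.le hp0.le
    exact rpow_le_rpow (by positivity) (by linarith) (by positivity)
  have h2 : 1 + t ^ 2 ≤ 2 * t ^ 2 := by nlinarith
  have e3 : t ^ (p - 1) * t ^ (2 - p) = t := by
    rw [← rpow_add ht0]; ring_nf; exact rpow_one t
  have h4 := two_rpow_mul_rpow_le hp1 hp2
  have e5 : p ^ (3 - p) * p ^ (p - 1) = p ^ 2 := by
    rw [← rpow_add hp0]; ring_nf; norm_cast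
  have e6 : (p - 1) ^ (4 - p) * (p - 1) ^ (p - 1) = (p - 1) ^ 3 := by
    rw [← rpow_add hq, show 4 - p + (p - 1) = ((3 : ℕ) : ℝ) by push_cast; ring, rpow_natCast]
  rw [div_rpow hp0.le hq.le] at h4
  calc _ ≤ 2 * (2 * t ^ 2) * t ^ (p - 1) * (2 ^ ((2 - p) / p) * t ^ (2 - p)) /
          ((2 - p) / 4 * p) := by
        gcongr
    _ = 16 * 2 ^ ((2 - p) / p) * t ^ 3 / ((2 - p) * p) := by
        rw [show 2 * (2 * t ^ 2) * t ^ (p - 1) * (2 ^ ((2 - p) / p) * t ^ (2 - p))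
          = 4 * t ^ 2 * 2 ^ ((2 - p) / p) * (t ^ (p - 1) * t ^ (2 - p)) by ring, e3]
        field_simp; ring
    _ ≤ 16 * 2 ^ ((2 - p) / p) * (2 * p / (π * (p - 1))) ^ 3 / ((2 - p) * p) := by gcongr
    _ = 128 / π ^ 3 * p ^ 2 / ((p - 1) ^ 3 * (2 - p)) * 2 ^ ((2 - p) / p) := by field_simp; ring
    _ = 128 / π ^ 3 * p ^ (3 - p) / ((p - 1) ^ (4 - p) * (2 - p)) *
          (2 ^ ((2 - p) / p) * (p ^ (p - 1) / (p - 1) ^ (p - 1))) := by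
        rw [← e5, ← e6]; field_simp
    _ ≤ 128 / π ^ 3 * p ^ (3 - p) / ((p - 1) ^ (4 - p) * (2 - p)) * (π ^ 2 / 4) := by gcongr
    _ = _ := by field_simp; ring

lemma le_of_forall_exists_norm_support {k : ℂ → ℝ} {r m : ℝ} (hr : 0 < r) (hm : 0 ≤ m)
    (hk : ContinuousOn k (Metric.closedBall 0 r))
    (hsupp : ∀ z ∈ Metric.ball (0 : ℂ) r, k z ≤ 0 ∨ ∃ H : ℂ → ℂ,
      (∀ᶠ w in nhds z, DifferentiableAt ℂ H w ∧ ‖H w‖ ≤ k w) ∧ ‖H z‖ = k z)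
    (hb : ∀ z ∈ Metric.sphere (0 : ℂ) r, k z ≤ m) : k 0 ≤ m := by
  by_contra! hcon
  have hcomp : IsCompact (Metric.closedBall (0 : ℂ) r) := isCompact_closedBall _ _
  obtain ⟨z₀, hz₀, hmax⟩ := hcomp.exists_isMaxOn ⟨0, by simp [hr.le]⟩ hk
  set S := k z₀
  have h0S : k 0 ≤ S := hmax (by simp [hr.le])
  have hA : IsCompact (Metric.closedBall (0 : ℂ) r ∩ k ⁻¹' {S}) :=
    hcomp.of_isClosed_subset (hk.preimage_isClosed_of_isClosed hcomp.isClosed isClosed_singleton)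
      Set.inter_subset_left
  obtain ⟨z, ⟨hzK, hzS⟩, hzmax⟩ := hA.exists_isMaxOn ⟨z₀, hz₀, rfl⟩ continuous_norm.continuousOn
  have hzS : k z = S := hzS
  have hzball : z ∈ Metric.ball (0 : ℂ) r := by
    rcases (Metric.mem_closedBall.1 hzK).lt_or_eq with h | h
    · exact h
    · have := hb z h; linarith
  have hnhds : ∀ᶠ w in nhds z, w ∈ Metric.ball (0 : ℂ) r := Metric.isOpen_ball.mem_nhds hzball
  rcases hsupp z hzball with h | ⟨H, hH, hHz⟩
  · linarith
  have hloc : IsLocalMax (norm ∘ H) z := by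
    filter_upwards [hH, hnhds] with w hw hwb
    have : k w ≤ S := hmax (Metric.ball_subset_closedBall hwb)
    simp only [Function.comp]
    linarith [hw.2]
  have heq := Complex.eventually_eq_of_isLocalMax_norm (hH.mono fun w hw => hw.1) hloc
  have hidmax : IsLocalMax (norm ∘ (id : ℂ → ℂ)) z := by
    filter_upwards [hH, hnhds, heq] with w hw hwb hwe
    have h1 : k w ≤ S := hmax (Metric.ball_subset_closedBall hwb)
    refine hzmax ⟨Metric.ball_subset_closedBall hwb, ?_⟩
    refine le_antisymm h1 ?_
    rw [← hzS, ← hHz, ← hwe]; exact hw.2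
  have hid := Complex.eventually_eq_of_isLocalMax_norm
    (Filter.Eventually.of_forall fun w => differentiableAt_id) hidmax
  have : {z} ∈ nhds z := by filter_upwards [hid] with w hw using hw
  have hbot := (inferInstance : (nhdsWithin z {z}ᶜ).NeBot)
  rw [← mem_interior_iff_mem_nhds, interior_singleton] at this
  exact this

lemma continuous_foldedPow {p : ℝ} (hp : 0 < p) : Continuous (foldedPow p) := by
  have hf : Continuous fun w : ℂ => (⟨|w.re|, w.im⟩ : ℂ) := by
    have : (fun w : ℂ => (⟨|w.re|, w.im⟩ : ℂ))
        = fun w => Complex.equivRealProdCLM.symm (|w.re|, w.im) := by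
      rfl
    rw [this]
    fun_prop
  rw [continuous_iff_continuousAt]
  intro w
  refine Complex.continuous_re.continuousAt.comp ?_
  by_cases h : (⟨|w.re|, w.im⟩ : ℂ) ∈ Complex.slitPlane
  · exact hf.continuousAt.cpow continuousAt_const h
  · have h0 : (⟨|w.re|, w.im⟩ : ℂ) = 0 := by
      rw [Complex.mem_slitPlane_iff, not_or] at h
      have h1 : |w.re| = 0 := le_antisymm (not_lt.1 h.1) (abs_nonneg _)
      have h2 : w.im = 0 := not_not.1 h.2
      apply Complex.ext <;> simp [h1, h2]
    have hcp : ContinuousAt (fun z : ℂ × ℂ => z.1 ^ z.2) ((⟨|w.re|, w.im⟩ : ℂ), (p : ℂ)) := by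
      rw [h0]; exact Complex.continuousAt_cpow_zero_of_re_pos (by simpa)
    exact ContinuousAt.comp (f := fun w : ℂ => ((⟨|w.re|, w.im⟩ : ℂ), (p : ℂ))) hcp
      (hf.continuousAt.prodMk continuousAt_const)

lemma foldedPow_neg (p : ℝ) (w : ℂ) (hw : w.re ≠ 0) : foldedPow p (-w) = foldedPow p w := by
  have h : ∀ z : ℂ, 0 < z.re → (starRingEnd ℂ z ^ (p : ℂ)).re = (z ^ (p : ℂ)).re := by
    intro z hz
    rw [Complex.cpow_ofReal_re, Complex.cpow_ofReal_re, Complex.norm_conj, Complex.arg_conj,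
      if_neg, neg_mul, cos_neg]
    intro h
    rw [Complex.arg_eq_pi_iff] at h; linarith
  have := h ⟨|w.re|, w.im⟩ (abs_pos.2 hw)
  rw [foldedPow, foldedPow, ← this]
  congr 3
  simp

lemma foldedPow_of_re_nonneg (p : ℝ) {w : ℂ} (hw : 0 ≤ w.re) :
    foldedPow p w = (w ^ (p : ℂ)).re := by
  rw [foldedPow, abs_of_nonneg hw]

lemma re_cpow_le_foldedPow {p : ℝ} (hp1 : 1 < p) (hp2 : p < 2) (w : ℂ) :
    (w ^ (p : ℂ)).re ≤ foldedPow p w := by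
  have hπ := pi_pos
  rcases le_total 0 w.re with h | h
  · rw [foldedPow_of_re_nonneg p h]
  set w' : ℂ := ⟨|w.re|, w.im⟩ with hw'
  have hnorm : ‖w'‖ = ‖w‖ := by
    rw [Complex.norm_def, Complex.norm_def, Complex.normSq_apply, Complex.normSq_apply]
    simp [hw', abs_mul_abs_self]
  rcases eq_or_ne w 0 with rfl | hw0
  · simp [foldedPow, show (⟨0, 0⟩ : ℂ) = 0 from rfl]
  have hpos : 0 < ‖w‖ := norm_pos_iff.2 hw0
  have h1 : |w'.arg| ≤ π / 2 := Complex.abs_arg_le_pi_div_two_iff.2 (abs_nonneg _)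
  have hcos : cos w.arg = - cos w'.arg := by
    have e1 := Complex.norm_mul_cos_arg w
    have e2 := Complex.norm_mul_cos_arg w'
    rw [hnorm] at e2
    have e3 : w'.re = -w.re := by simp [hw', abs_of_nonpos h]
    have : ‖w‖ * (cos w.arg + cos w'.arg) = 0 := by rw [mul_add, e1, e2, e3]; ring
    have := (mul_eq_zero.1 this).resolve_left hpos.ne'
    linarith
  have habs : |w.arg| = π - |w'.arg| := by
    apply injOn_cos ⟨abs_nonneg _, Complex.abs_arg_le_pi w⟩
      ⟨by linarith, by linarith [abs_nonneg w'.arg]⟩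
    rw [cos_pi_sub, cos_abs, cos_abs, hcos]
  rw [foldedPow, Complex.cpow_ofReal_re, Complex.cpow_ofReal_re]
  have e1 : cos (w.arg * p) = cos ((π - |w'.arg|) * p) := by
    rw [← cos_abs, abs_mul, habs, abs_of_pos (by linarith : 0 < p)]
  have e2 : cos (w'.arg * p) = cos (|w'.arg| * p) := by
    rw [← cos_abs, abs_mul, abs_of_pos (by linarith : 0 < p)]
  rw [hnorm, e1, e2]
  refine mul_le_mul_of_nonneg_left ?_ (by positivity)
  rw [← sub_nonneg, cos_sub_cos]
  have h3 : (|w'.arg| * p + (π - |w'.arg|) * p) / 2 = p * π / 2 := by ring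
  have h4 : (|w'.arg| * p - (π - |w'.arg|) * p) / 2 = -(p * (π / 2 - |w'.arg|)) := by ring
  rw [h3, h4, sin_neg]
  have h5 : 0 ≤ sin (p * π / 2) := sin_nonneg_of_nonneg_of_le_pi (by positivity) (by nlinarith)
  have h6 : 0 ≤ sin (p * (π / 2 - |w'.arg|)) := by
    apply sin_nonneg_of_nonneg_of_le_pi
    · have : 0 ≤ π / 2 - |w'.arg| := by linarith
      positivity
    · nlinarith [abs_nonneg w'.arg]
  nlinarith [mul_nonneg h5 h6]

lemma exists_holomorphic_support_foldedPow {p : ℝ} (hp1 : 1 < p) (hp2 : p < 2) {w₀ : ℂ}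
    (hw₀ : w₀ ≠ 0) : ∃ H : ℂ → ℂ, (∀ᶠ w in nhds w₀, DifferentiableAt ℂ H w ∧
      (H w).re ≤ foldedPow p w) ∧ (H w₀).re = foldedPow p w₀ := by
  rcases le_or_gt 0 w₀.re with h | h
  · have hs : w₀ ∈ Complex.slitPlane := by
      rw [Complex.mem_slitPlane_iff]
      by_contra! hc
      exact hw₀ (Complex.ext (le_antisymm hc.1 h) hc.2)
    refine ⟨fun w => w ^ (p : ℂ), ?_, (foldedPow_of_re_nonneg p h).symm⟩
    filter_upwards [Complex.isOpen_slitPlane.mem_nhds hs] with w hw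
    exact ⟨differentiableAt_id.cpow_const hw, re_cpow_le_foldedPow hp1 hp2 w⟩
  · refine ⟨fun w => (-w) ^ (p : ℂ), ?_, ?_⟩
    · filter_upwards [(isOpen_lt Complex.continuous_re continuous_const).mem_nhds h] with w hw
      have hw : w.re < 0 := hw
      have hs : -w ∈ Complex.slitPlane := by
        rw [Complex.mem_slitPlane_iff]; left; simpa using hw
      refine ⟨differentiableAt_id.neg.cpow_const hs, ?_⟩
      rw [← foldedPow_neg p w hw.ne]
      exact re_cpow_le_foldedPow hp1 hp2 _
    · rw [← foldedPow_neg p w₀ h.ne, foldedPow_of_re_nonneg]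
      simpa using h.le

lemma exists_differentiable_re_approx {q : ℂ → ℝ} {r ε : ℝ} (hr : 0 < r) (hε : 0 < ε)
    (hq : ContinuousOn q (Metric.sphere 0 r)) :
    ∃ P : ℂ → ℂ, Differentiable ℂ P ∧ ∀ z ∈ Metric.sphere (0 : ℂ) r, |q z - (P z).re| ≤ ε := by
  have : Fact (0 < 2 * π) := ⟨by positivity⟩
  let e : AddCircle (2 * π) → ℂ := fun x => r * (AddCircle.toCircle x : ℂ)
  have he : Continuous e := by fun_prop
  have hes : ∀ x, e x ∈ Metric.sphere (0 : ℂ) r := by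
    intro x
    simp [e, abs_of_pos hr, Circle.norm_coe]
  let qc : C(AddCircle (2 * π), ℂ) := ⟨fun x => (q (e x) : ℂ),
    Complex.continuous_ofReal.comp (hq.comp_continuous he hes)⟩
  have hmem : qc ∈ (Submodule.span ℂ (Set.range <| @fourier (2 * π))).topologicalClosure := by
    rw [span_fourier_closure_eq_top]; trivial
  have hmem' : qc ∈ closure (Submodule.span ℂ (Set.range <| @fourier (2 * π)) :
    Set C(AddCircle (2 * π), ℂ)) := hmem
  obtain ⟨g, hg, hdist⟩ := Metric.mem_closure_iff.1 hmem' ε hε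
  have hrep : ∃ P₁ P₂ : ℂ → ℂ, Differentiable ℂ P₁ ∧ Differentiable ℂ P₂ ∧
      ∀ x, g x = P₁ (e x) + starRingEnd ℂ (P₂ (e x)) := by
    clear hdist
    induction hg using Submodule.span_induction with
    | mem g hg =>
      obtain ⟨n, rfl⟩ := hg
      have hr' : (r : ℂ) ≠ 0 := by exact_mod_cast hr.ne'
      obtain ⟨m, rfl | rfl⟩ := n.eq_nat_or_neg
      · refine ⟨fun z => (z / r) ^ m, 0, by fun_prop, differentiable_const _, fun x => ?_⟩
        simp [e, hr', fourier_apply, AddCircle.toCircle_nsmul]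
      · refine ⟨0, fun z => (z / r) ^ m, differentiable_const _, by fun_prop, fun x => ?_⟩
        simp [e, hr', fourier_apply, AddCircle.toCircle_nsmul, AddCircle.toCircle_neg,
          ← Circle.coe_inv_eq_conj]
    | zero => exact ⟨0, 0, differentiable_const _, differentiable_const _, by simp⟩
    | add g h _ _ ihg ihh =>
      obtain ⟨P₁, P₂, h1, h2, h3⟩ := ihg
      obtain ⟨Q₁, Q₂, h4, h5, h6⟩ := ihh
      refine ⟨P₁ + Q₁, P₂ + Q₂, h1.add h4, h2.add h5, fun x => ?_⟩
      simp [h3, h6]; ring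
    | smul c g _ ihg =>
      obtain ⟨P₁, P₂, h1, h2, h3⟩ := ihg
      refine ⟨c • P₁, starRingEnd ℂ c • P₂, h1.const_smul _, h2.const_smul _, fun x => ?_⟩
      simp [h3]; ring
  obtain ⟨P₁, P₂, h1, h2, h3⟩ := hrep
  refine ⟨P₁ + P₂, h1.add h2, fun z hz => ?_⟩
  have hz' : ‖z‖ = r := by simpa using hz
  obtain ⟨x, hx⟩ : ∃ x : AddCircle (2 * π), e x = z := by
    refine ⟨(z.arg : AddCircle (2 * π)), ?_⟩
    simp only [e, AddCircle.toCircle_apply_mk, Circle.coe_exp]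
    rw [div_self (by positivity), one_mul, ← hz', Complex.norm_mul_exp_arg_mul_I]
  have h4 : ‖qc x - g x‖ ≤ ε := by
    rw [← dist_eq_norm]; exact (ContinuousMap.dist_apply_le_dist x).trans hdist.le
  have h5 : (qc x - g x).re = q z - ((P₁ + P₂) z).re := by
    simp [qc, h3, hx]
  rw [← h5]
  exact (Complex.abs_re_le_norm _).trans h4

lemma foldedPow_le_circleAverage_of_ne_zero {p : ℝ} (hp1 : 1 < p) (hp2 : p < 2) {G : ℂ → ℂ} {r : ℝ}
    (hr : 0 < r) (hG : DiffContOnCl ℂ G (Metric.ball 0 r)) (hG0 : G 0 ≠ 0) :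
    foldedPow p (G 0) ≤ circleAverage (fun z => foldedPow p (G z)) 0 r := by
  have hGc : ContinuousOn G (Metric.closedBall 0 r) := by
    rw [← closure_ball _ hr.ne']; exact hG.continuousOn
  have hΦ : ContinuousOn (fun z => foldedPow p (G z)) (Metric.closedBall 0 r) :=
    (continuous_foldedPow (by linarith)).comp_continuousOn hGc
  have hΦs := hΦ.mono Metric.sphere_subset_closedBall
  refine le_of_forall_pos_le_add fun ε hε => ?_
  obtain ⟨P, hP, hPq⟩ := exists_differentiable_re_approx hr (half_pos hε) hΦs
  have hPc := hP.continuous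
  have hinteg : CircleIntegrable (fun z => foldedPow p (G z)) 0 r := hΦs.circleIntegrable hr.le
  have hPint : CircleIntegrable (fun z => (P z).re) 0 r :=
    (Complex.continuous_re.comp hPc).continuousOn.circleIntegrable hr.le
  have hP0 : (P 0).re ≤ circleAverage (fun z => foldedPow p (G z)) 0 r + ε / 2 := by
    have h1 : circleAverage (fun z => (P z).re) 0 r = (P 0).re := by
      have h2 := DiffContOnCl.circleAverage (f := P) (c := 0) (R := r) hP.diffContOnCl
      rw [← h2]
      exact Complex.reCLM.circleAverage_comp_comm (hPc.continuousOn.circleIntegrable hr.le)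
    rw [← h1]
    have h3 : circleAverage (fun z => foldedPow p (G z) + ε / 2) 0 r
        = circleAverage (fun z => foldedPow p (G z)) 0 r + ε / 2 := by
      rw [circleAverage_fun_add hinteg (circleIntegrable_const _ _ _), circleAverage_const]
    rw [← h3]
    refine circleAverage_mono hPint (hinteg.add (circleIntegrable_const _ _ _)) fun z hz => ?_
    rw [abs_of_pos hr] at hz
    have := abs_le.1 (hPq z hz)
    linarith [this.1]
  suffices h : foldedPow p (G 0) - (P 0).re ≤ ε / 2 by linarith
  obtain ⟨M, hM⟩ := (isCompact_closedBall (0 : ℂ) r).exists_bound_of_continuousOn hGc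
  have hM0 : 0 < ‖G 0‖ := norm_pos_iff.2 hG0
  have hMG : ‖G 0‖ ≤ M := hM 0 (by simp [hr.le])
  have hN : ∀ N : ℕ, ‖G 0‖ * exp (N * (foldedPow p (G 0) - (P 0).re)) ≤ M * exp (N * (ε / 2)) := by
    intro N
    refine le_of_forall_exists_norm_support
      (k := fun z => ‖G z‖ * exp (N * (foldedPow p (G z) - (P z).re))) hr ?_ ?_ ?_ ?_
    · have : 0 ≤ M := hM0.le.trans hMG
      positivity
    · exact hGc.norm.mul (Real.continuous_exp.comp_continuousOn (continuousOn_const.mul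
        (hΦ.sub (Complex.continuous_re.comp hPc).continuousOn)))
    · intro z hz
      rcases eq_or_ne (G z) 0 with h0 | h0
      · left; simp [h0]
      right
      obtain ⟨H, hH, hHz⟩ := exists_holomorphic_support_foldedPow hp1 hp2 h0
      have hd : ∀ᶠ w in nhds z, DifferentiableAt ℂ G w := by
        filter_upwards [Metric.isOpen_ball.mem_nhds hz] with w hw
        exact hG.differentiableAt Metric.isOpen_ball hw
      have hc : Filter.Tendsto G (nhds z) (nhds (G z)) := hd.self_of_nhds.continuousAt
      have hn : ∀ w, ‖G w * Complex.exp (N * (H (G w) - P w))‖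
          = ‖G w‖ * exp (N * ((H (G w)).re - (P w).re)) := by
        intro w
        rw [norm_mul, Complex.norm_exp]
        simp
      refine ⟨fun w => G w * Complex.exp (N * (H (G w) - P w)), ?_, ?_⟩
      · filter_upwards [hd, hc.eventually hH] with w hw1 hw2
        refine ⟨hw1.mul (((hw2.1.comp w hw1).sub (hP w)).const_mul _).cexp, ?_⟩
        rw [hn]
        gcongr
        exact hw2.2
      · rw [hn, hHz]
    · intro z hz
      have h1 := hM z (Metric.sphere_subset_closedBall hz)
      have h2 := (abs_le.1 (hPq z hz)).2
      have : 0 ≤ M := hM0.le.trans hMG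
      gcongr
  by_contra! hcon
  set δ := foldedPow p (G 0) - (P 0).re - ε / 2 with hδ
  have hδ0 : 0 < δ := by linarith
  obtain ⟨N, hNN⟩ := exists_nat_gt (M / ‖G 0‖ / δ)
  rw [div_lt_iff₀ hδ0, div_lt_iff₀ hM0] at hNN
  have h1 := hN N
  have h2 : exp (N * (foldedPow p (G 0) - (P 0).re)) = exp (N * δ) * exp (N * (ε / 2)) := by
    rw [← exp_add]; congr 1; rw [hδ]; ring
  rw [h2, ← mul_assoc] at h1
  have h3 := le_of_mul_le_mul_right h1 (exp_pos _)
  have h4 := add_one_le_exp (N * δ)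
  nlinarith

lemma foldedPow_le_circleAverage {p : ℝ} (hp1 : 1 < p) (hp2 : p < 2) {G : ℂ → ℂ} {r : ℝ}
    (hr : 0 < r) (hG : DiffContOnCl ℂ G (Metric.ball 0 r)) :
    foldedPow p (G 0) ≤ circleAverage (fun z => foldedPow p (G z)) 0 r := by
  rcases ne_or_eq (G 0) 0 with h0 | h0
  · exact foldedPow_le_circleAverage_of_ne_zero hp1 hp2 hr hG h0
  have hΦ := continuous_foldedPow (p := p) (by linarith)
  have hGc : Continuous fun θ => G (circleMap 0 r θ) := by
    refine hG.continuousOn.comp_continuous (continuous_circleMap 0 r) fun θ => ?_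
    rw [closure_ball _ hr.ne']
    exact circleMap_mem_closedBall 0 hr.le θ
  have hcont : Continuous fun c : ℝ => circleAverage (fun z => foldedPow p (G z + c)) 0 r := by
    simp only [circleAverage_def]
    refine Continuous.const_smul (M := ℝ) ?_ _
    apply intervalIntegral.continuous_parametric_intervalIntegral_of_continuous'
    simp only [Function.uncurry_def]
    exact hΦ.comp ((hGc.comp continuous_snd).add (Complex.continuous_ofReal.comp continuous_fst))
  have hcont0 : Continuous fun c : ℝ => foldedPow p (G 0 + c) := by fun_prop
  have h1 : ∀ᶠ c : ℝ in nhdsWithin 0 {0}ᶜ,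
      foldedPow p (G 0 + c) ≤ circleAverage (fun z => foldedPow p (G z + c)) 0 r := by
    filter_upwards [self_mem_nhdsWithin] with c hc
    refine foldedPow_le_circleAverage_of_ne_zero (G := fun z => G z + c) hp1 hp2 hr
      (hG.add_const _) ?_
    simpa [h0] using hc
  have := le_of_tendsto_of_tendsto (hcont0.continuousAt.mono_left nhdsWithin_le_nhds)
    (hcont.continuousAt.mono_left nhdsWithin_le_nhds) h1
  simpa using this

lemma cayley_im (z : ℂ) :
    (Complex.I * (1 - z) / (1 + z)).im = (1 - ‖z‖ ^ 2) / ‖1 + z‖ ^ 2 := by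
  rw [← Complex.normSq_eq_norm_sq, ← Complex.normSq_eq_norm_sq, Complex.div_im]
  simp [Complex.normSq_apply]
  rw [← sub_div]
  congr 1
  ring

lemma cayley_exp_two_arctan (s : ℝ) :
    Complex.I * (1 - Complex.exp ((2 * arctan s : ℝ) * Complex.I)) /
      (1 + Complex.exp ((2 * arctan s : ℝ) * Complex.I)) = s := by
  have hc := cos_arctan_pos s
  have hsin : sin (arctan s) = s * cos (arctan s) := by
    have h := tan_arctan s
    rw [tan_eq_sin_div_cos, div_eq_iff hc.ne'] at h
    exact h
  have hsq : cos (arctan s) ^ 2 * (1 + s ^ 2) = 1 := by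
    have h := sin_sq_add_cos_sq (arctan s)
    rw [hsin] at h; linarith
  set γ := cos (arctan s)
  have hE : Complex.exp ((2 * arctan s : ℝ) * Complex.I) = (γ * (1 + s * Complex.I)) ^ 2 := by
    rw [show ((2 * arctan s : ℝ) : ℂ) * Complex.I = ((2 : ℕ) : ℂ) * ((arctan s : ℝ) * Complex.I) by
      push_cast; ring, Complex.exp_nat_mul, Complex.exp_mul_I, ← Complex.ofReal_cos,
      ← Complex.ofReal_sin, hsin, Complex.ofReal_mul]
    ring
  have hsq' : (γ : ℂ) ^ 2 * (1 + s ^ 2) = 1 := by exact_mod_cast hsq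
  have h1s : (1 - s * Complex.I) ≠ 0 := by
    intro h
    have := congrArg Complex.re h
    simp at this
  have h2 : (1 + Complex.exp ((2 * arctan s : ℝ) * Complex.I)) * (1 - s * Complex.I) = 2 := by
    rw [hE]
    linear_combination (1 + s * Complex.I) * hsq' +
      (γ ^ 2 * s ^ 2 * (-1 - s * Complex.I)) * Complex.I_sq
  have hne : (1 + Complex.exp ((2 * arctan s : ℝ) * Complex.I)) ≠ 0 := by
    intro h; rw [h, zero_mul] at h2; norm_num at h2
  rw [div_eq_iff hne]
  apply mul_right_cancel₀ h1s
  have h3 : Complex.exp ((2 * arctan s : ℝ) * Complex.I) * (1 - s * Complex.I)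
      = 1 + s * Complex.I := by linear_combination h2
  linear_combination (-Complex.I - s) * h3 - 2 * s * Complex.I_sq

lemma integral_two_arctan (F : ℝ → ℝ) :
    ∫ θ in (-π)..π, F θ = ∫ s : ℝ, 2 / (1 + s ^ 2) * F (2 * arctan s) := by
  have himg : (fun s => 2 * arctan s) '' Set.univ = Set.Ioo (-π) π := by
    rw [Set.image_univ]
    ext θ
    constructor
    · rintro ⟨s, rfl⟩
      constructor
      · simp only; linarith [neg_pi_div_two_lt_arctan s]
      · simp only; linarith [arctan_lt_pi_div_two s]
    · rintro ⟨h1, h2⟩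
      exact ⟨tan (θ / 2), by simp only; rw [arctan_tan (by linarith) (by linarith)]; ring⟩
  rw [intervalIntegral.integral_of_le (by linarith [pi_pos]), integral_Ioc_eq_integral_Ioo, ← himg,
    integral_image_eq_integral_abs_deriv_smul (f' := fun s => 2 * (1 / (1 + s ^ 2)))
      MeasurableSet.univ (fun s _ => ((hasDerivAt_arctan s).const_mul 2).hasDerivWithinAt)
      (fun a _ b _ h => arctan_injective (by simpa using h))]
  rw [setIntegral_univ]
  congr 1 with s
  rw [abs_of_nonneg (by positivity), smul_eq_mul]
  ring

lemma foldedPow_I_le_integral {p M : ℝ} (hp1 : 1 < p) (hp2 : p < 2) {g : ℂ → ℂ}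
    (hgc : ContinuousOn g {z | 0 ≤ z.im}) (hgd : DifferentiableOn ℂ g {z | 0 < z.im})
    (hgM : ∀ z, 0 ≤ z.im → ‖g z‖ ≤ M) :
    π * foldedPow p (g Complex.I) ≤ ∫ s : ℝ, 1 / (1 + s ^ 2) * foldedPow p (g s) := by
  have hπ := pi_pos
  have hp0 : 0 < p := by linarith
  have hΦ := continuous_foldedPow hp0
  set φ : ℂ → ℂ := fun z => Complex.I * (1 - z) / (1 + z) with hφ
  have hne : ∀ z : ℂ, ‖z‖ < 1 → 1 + z ≠ 0 := by
    intro z hz h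
    have : z = -1 := by linear_combination h
    rw [this] at hz; simp at hz
  have him : ∀ z : ℂ, ‖z‖ ≤ 1 → 0 ≤ (φ z).im := by
    intro z hz
    rw [cayley_im]
    have : ‖z‖ ^ 2 ≤ 1 := pow_le_one₀ (norm_nonneg _) hz
    exact div_nonneg (by linarith) (by positivity)
  have him' : ∀ z : ℂ, ‖z‖ < 1 → 0 < (φ z).im := by
    intro z hz
    rw [cayley_im]
    have : ‖z‖ ^ 2 < 1 := pow_lt_one₀ (norm_nonneg _) hz two_ne_zero
    have := norm_pos_iff.2 (hne z hz)
    exact div_pos (by linarith) (by positivity)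
  have hφd : ∀ z : ℂ, 1 + z ≠ 0 → DifferentiableAt ℂ φ z := by
    intro z hz
    exact ((differentiableAt_const _).mul ((differentiableAt_const _).sub differentiableAt_id)).div
      ((differentiableAt_const _).add differentiableAt_id) hz
  have hE : ∀ θ : ℝ, ‖Complex.exp (θ * Complex.I)‖ = 1 := Complex.norm_exp_ofReal_mul_I
  have hstep : ∀ r ∈ Set.Ioo (0 : ℝ) 1, 2 * π * foldedPow p (g Complex.I)
      ≤ ∫ θ in (-π)..π, foldedPow p (g (φ (r * Complex.exp (θ * Complex.I)))) := by
    intro r hr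
    have hrz : ∀ z ∈ Metric.closedBall (0 : ℂ) r, ‖z‖ < 1 := by
      intro z hz
      rw [mem_closedBall_zero_iff] at hz; linarith [hr.2]
    have hG : DiffContOnCl ℂ (fun z => g (φ z)) (Metric.ball 0 r) := by
      apply DifferentiableOn.diffContOnCl
      rw [closure_ball _ hr.1.ne']
      intro z hz
      have h1 := hgd.differentiableAt ((isOpen_lt continuous_const Complex.continuous_im).mem_nhds
        (him' z (hrz z hz)))
      exact (h1.comp z (hφd z (hne z (hrz z hz)))).differentiableWithinAt
    have h := foldedPow_le_circleAverage hp1 hp2 hr.1 hG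
    have h0 : φ 0 = Complex.I := by simp [hφ]
    rw [h0, circleAverage_eq_integral_add (-π), smul_eq_mul,
      intervalIntegral.integral_comp_add_right
        (fun θ => foldedPow p (g (φ (circleMap 0 r θ)))) (-π)] at h
    rw [show (0 : ℝ) + -π = -π by ring, show 2 * π + -π = π by ring, inv_mul_eq_div,
      le_div_iff₀ (by positivity)] at h
    simp only [circleMap, zero_add] at h
    linarith
  have hlim : Filter.Tendsto (fun r : ℝ => ∫ θ in (-π)..π,
      foldedPow p (g (φ (r * Complex.exp (θ * Complex.I))))) (nhdsWithin 1 (Set.Ioo 0 1))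
      (nhds (∫ θ in (-π)..π, foldedPow p (g (φ (Complex.exp (θ * Complex.I)))))) := by
    apply intervalIntegral.tendsto_integral_filter_of_dominated_convergence (fun _ => M ^ p)
    · filter_upwards [self_mem_nhdsWithin] with r hr
      apply Continuous.aestronglyMeasurable
      refine hΦ.comp (hgc.comp_continuous ?_ ?_)
      · rw [continuous_iff_continuousAt]
        intro θ
        refine ContinuousAt.comp (g := φ) (f := fun θ : ℝ => (r : ℂ) * Complex.exp (θ * Complex.I))
          (hφd _ (hne _ ?_)).continuousAt (by fun_prop)
        rw [norm_mul, hE, mul_one, Complex.norm_real, norm_of_nonneg hr.1.le]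
        exact hr.2
      · intro θ
        apply him
        rw [norm_mul, hE, mul_one, Complex.norm_real, norm_of_nonneg hr.1.le]
        exact hr.2.le
    · filter_upwards [self_mem_nhdsWithin] with r hr
      refine Filter.Eventually.of_forall fun θ _ => ?_
      refine (abs_foldedPow_le hp0 _).trans ?_
      refine rpow_le_rpow (norm_nonneg _) (hgM _ (him _ ?_)) hp0.le
      rw [norm_mul, hE, mul_one, Complex.norm_real, norm_of_nonneg hr.1.le]
      exact hr.2.le
    · exact intervalIntegrable_const
    · have hfin : ∀ᵐ θ : ℝ, θ ∉ ({π} : Set ℝ) :=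
        measure_eq_zero_iff_ae_notMem.1 (measure_singleton π)
      filter_upwards [hfin] with θ hθ hθ'
      rw [Set.uIoc_of_le (by linarith)] at hθ'
      have hE1 : 1 + Complex.exp (θ * Complex.I) ≠ 0 := by
        intro h
        have h1 : Complex.exp (θ * Complex.I) = -1 := by linear_combination h
        have h2 : Complex.arg (Complex.exp (θ * Complex.I)) = θ := by
          rw [Complex.arg_exp_mul_I, toIocMod_eq_self]
          exact ⟨hθ'.1, by linarith [hθ'.2]⟩
        rw [h1, Complex.arg_neg_one] at h2
        exact hθ h2.symm
      have hc1 : Filter.Tendsto (fun r : ℝ => φ (r * Complex.exp (θ * Complex.I)))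
          (nhdsWithin 1 (Set.Ioo 0 1)) (nhds (φ (Complex.exp (θ * Complex.I)))) := by
        have h1 : ContinuousAt (fun r : ℝ => φ (r * Complex.exp (θ * Complex.I))) 1 := by
          refine ContinuousAt.comp (g := φ)
            (f := fun r : ℝ => (r : ℂ) * Complex.exp (θ * Complex.I)) ?_ (by fun_prop)
          rw [Complex.ofReal_one, one_mul]
          exact (hφd _ hE1).continuousAt
        have h2 := h1.tendsto.mono_left (nhdsWithin_le_nhds (s := Set.Ioo 0 1))
        simpa using h2
      have hc2 : Filter.Tendsto (fun r : ℝ => φ (r * Complex.exp (θ * Complex.I)))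
          (nhdsWithin 1 (Set.Ioo 0 1))
          (nhdsWithin (φ (Complex.exp (θ * Complex.I))) {z | 0 ≤ z.im}) := by
        refine tendsto_nhdsWithin_iff.2 ⟨hc1, ?_⟩
        filter_upwards [self_mem_nhdsWithin] with r hr
        apply him
        rw [norm_mul, hE, mul_one, Complex.norm_real, norm_of_nonneg hr.1.le]
        exact hr.2.le
      exact (hΦ.tendsto _).comp ((hgc _ (him _ (hE θ).le)).tendsto.comp hc2)
  have hbot : (nhdsWithin (1 : ℝ) (Set.Ioo 0 1)).NeBot := by
    rw [nhdsWithin_Ioo_eq_nhdsLT zero_lt_one]; infer_instance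
  have hfinal := ge_of_tendsto hlim (by
    filter_upwards [self_mem_nhdsWithin] with r hr using hstep r hr)
  rw [integral_two_arctan (fun θ => foldedPow p (g (φ (Complex.exp (θ * Complex.I)))))] at hfinal
  have e : ∀ s : ℝ, 2 / (1 + s ^ 2) * foldedPow p (g (φ (Complex.exp ((2 * arctan s : ℝ)
      * Complex.I)))) = 2 * (1 / (1 + s ^ 2) * foldedPow p (g s)) := by
    intro s
    rw [hφ]; simp only
    rw [cayley_exp_two_arctan]; ring
  simp only [e] at hfinal
  rw [integral_const_mul] at hfinal
  linarith

lemma foldedPow_mul_I_le_integral {p M Y : ℝ} (hp1 : 1 < p) (hp2 : p < 2) (hY : 0 < Y) {g : ℂ → ℂ}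
    (hgc : ContinuousOn g {z | 0 ≤ z.im}) (hgd : DifferentiableOn ℂ g {z | 0 < z.im})
    (hgM : ∀ z, 0 ≤ z.im → ‖g z‖ ≤ M) :
    Y * π * foldedPow p (g (Y * Complex.I)) ≤
      ∫ s : ℝ, Y ^ 2 / (Y ^ 2 + s ^ 2) * foldedPow p (g s) := by
  have h := foldedPow_I_le_integral (g := fun z => g (Y * z)) hp1 hp2 (M := M)
    (hgc.comp (by fun_prop) fun z hz => by
      simp only [Set.mem_ofPred_eq] at hz ⊢; simpa using mul_nonneg hY.le hz)
    (hgd.comp (by fun_prop) fun z hz => by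
      simp only [Set.mem_ofPred_eq] at hz ⊢; simpa using mul_pos hY hz)
    (fun z hz => hgM _ (by simpa using mul_nonneg hY.le hz))
  have e := Measure.integral_comp_mul_left
    (fun s : ℝ => Y ^ 2 / (Y ^ 2 + s ^ 2) * foldedPow p (g s)) Y
  have e2 : ∀ s : ℝ, Y ^ 2 / (Y ^ 2 + (Y * s) ^ 2) * foldedPow p (g ((Y * s : ℝ) : ℂ))
      = 1 / (1 + s ^ 2) * foldedPow p (g (Y * s)) := by
    intro s
    rw [Complex.ofReal_mul]
    congr 1
    field_simp
  simp only [e2] at e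
  rw [e, abs_of_pos (by positivity), smul_eq_mul, inv_mul_eq_div, le_div_iff₀ hY] at h
  linarith

lemma lintegral_le_of_holomorphic {p M C a b : ℝ} (hp1 : 1 < p) (hp2 : p < 2) (ha : 0 ≤ a)
    (hb : 0 ≤ b) (hab : ∀ w : ℂ, 0 ≤ a * |w.re| ^ p - b * foldedPow p w) {g : ℂ → ℂ}
    (hgc : ContinuousOn g {z | 0 ≤ z.im}) (hgd : DifferentiableOn ℂ g {z | 0 < z.im})
    (hgM : ∀ z, 0 ≤ z.im → ‖g z‖ ≤ M) (hgC : ∀ Y : ℝ, 0 < Y → ‖g (Y * Complex.I)‖ ≤ C / Y) :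
    ∫⁻ s : ℝ, ENNReal.ofReal (a * |(g s).re| ^ p - b * foldedPow p (g s)) ≤
      ∫⁻ s : ℝ, ENNReal.ofReal (a * |(g s).re| ^ p) := by
  have hp0 : 0 < p := by linarith
  have hΦ := continuous_foldedPow hp0
  have hgr : Continuous fun s : ℝ => g s := hgc.comp_continuous (by fun_prop) (by simp)
  have hC : 0 ≤ C := by
    have := (norm_nonneg _).trans (hgC 1 one_pos); simpa using this
  have hM : 0 ≤ M := (norm_nonneg _).trans (hgM 0 (by simp))
  set w : ℕ → ℝ → ℝ := fun n s => ((n : ℝ) + 1) ^ 2 / (((n : ℝ) + 1) ^ 2 + s ^ 2) with hw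
  have hw0 : ∀ n s, 0 ≤ w n s := fun n s => by positivity
  have hw1 : ∀ n s, w n s ≤ 1 := fun n s => by
    rw [hw]; simp only
    rw [div_le_one (by positivity)]; nlinarith [sq_nonneg s]
  have hwi : ∀ n, Integrable (w n) := by
    intro n
    have h := (integrable_inv_one_add_sq).comp_div (R := (n : ℝ) + 1) (by positivity)
    refine h.congr (Filter.Eventually.of_forall fun s => ?_)
    simp only [hw]
    field_simp
  have hwt : ∀ s, Filter.Tendsto (fun n => w n s) Filter.atTop (nhds 1) := by
    intro s
    have h1 : Filter.Tendsto (fun n : ℕ => ((n : ℝ) + 1) ^ 2 ) Filter.atTop Filter.atTop :=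
      (Filter.tendsto_pow_atTop two_ne_zero).comp
        (Filter.tendsto_atTop_add_const_right _ 1 tendsto_natCast_atTop_atTop)
    have h2 : Filter.Tendsto (fun n : ℕ => 1 - s ^ 2 / (((n : ℝ) + 1) ^ 2 + s ^ 2)) Filter.atTop
        (nhds (1 - 0)) :=
      tendsto_const_nhds.sub (Filter.Tendsto.div_atTop tendsto_const_nhds
        (Filter.tendsto_atTop_add_const_right _ _ h1))
    rw [sub_zero] at h2
    refine h2.congr fun n => ?_
    simp only [hw]
    field_simp
    ring
  set δ : ℕ → ℝ := fun n => b * (((n : ℝ) + 1) * π * (C / ((n : ℝ) + 1)) ^ p) with hδ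
  have hδt : Filter.Tendsto δ Filter.atTop (nhds 0) := by
    have h1 : Filter.Tendsto (fun n : ℕ => (n : ℝ) + 1) Filter.atTop Filter.atTop :=
      Filter.tendsto_atTop_add_const_right _ 1 tendsto_natCast_atTop_atTop
    have h2 := (tendsto_rpow_neg_atTop (show 0 < p - 1 by linarith)).comp h1
    have h3 := h2.const_mul (b * π * C ^ p)
    rw [mul_zero] at h3
    refine h3.congr fun n => ?_
    simp only [hδ, Function.comp]
    have hn : 0 < (n : ℝ) + 1 := by positivity
    rw [div_rpow hC hn.le, rpow_neg hn.le, rpow_sub hn, rpow_one]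
    field_simp
  have hΦi : ∀ n, Integrable fun s : ℝ => w n s * foldedPow p (g s) := by
    intro n
    refine (hwi n).mul_bdd (c := M ^ p) (hΦ.comp hgr).aestronglyMeasurable
      (Filter.Eventually.of_forall fun s => ?_)
    exact (abs_foldedPow_le hp0 _).trans
      (rpow_le_rpow (norm_nonneg _) (hgM _ (by simp)) hp0.le)
  have hRc : Continuous fun s : ℝ => |(g s).re| ^ p :=
    (Complex.continuous_re.comp hgr).abs.rpow_const fun _ => Or.inr hp0.le
  have hRi : ∀ n, Integrable fun s : ℝ => w n s * |(g s).re| ^ p := by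
    intro n
    refine (hwi n).mul_bdd (c := M ^ p) hRc.aestronglyMeasurable
      (Filter.Eventually.of_forall fun s => ?_)
    rw [norm_of_nonneg (by positivity)]
    exact rpow_le_rpow (abs_nonneg _) ((Complex.abs_re_le_norm _).trans (hgM _ (by simp))) hp0.le
  set A := ∫⁻ s : ℝ, ENNReal.ofReal (a * |(g s).re| ^ p) with hA
  have hstep : ∀ n, ∫⁻ s : ℝ, ENNReal.ofReal (w n s * (a * |(g s).re| ^ p - b * foldedPow p (g s)))
      ≤ A + ENNReal.ofReal (δ n) := by
    intro n
    have hn : 0 < (n : ℝ) + 1 := by positivity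
    have h1 : ∀ s, w n s * (a * |(g s).re| ^ p - b * foldedPow p (g s))
        = a * (w n s * |(g s).re| ^ p) - b * (w n s * foldedPow p (g s)) := fun s => by ring
    rw [← ofReal_integral_eq_lintegral_ofReal]
    · simp only [h1]
      rw [integral_sub ((hRi n).const_mul a) ((hΦi n).const_mul b), integral_const_mul b]
      have h2 := foldedPow_mul_I_le_integral hp1 hp2 hn hgc hgd hgM
      have h3 : -(((n : ℝ) + 1) * π * (C / ((n : ℝ) + 1)) ^ p) ≤
          ((n : ℝ) + 1) * π * foldedPow p (g (((n : ℝ) + 1 : ℝ) * Complex.I)) := by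
        have h4 : -(C / ((n : ℝ) + 1)) ^ p ≤ foldedPow p (g (((n : ℝ) + 1 : ℝ) * Complex.I)) :=
          (neg_le_neg (rpow_le_rpow (norm_nonneg _) (hgC _ hn) hp0.le)).trans
            (abs_le.1 (abs_foldedPow_le hp0 _)).1
        rw [← mul_neg]
        exact mul_le_mul_of_nonneg_left h4 (by positivity)
      have h5 := mul_le_mul_of_nonneg_left (h3.trans h2) hb
      have hδn : 0 ≤ δ n := by positivity
      calc _ ≤ ENNReal.ofReal ((∫ s, a * (w n s * |(g s).re| ^ p)) + δ n) := by
            apply ENNReal.ofReal_le_ofReal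
            simp only [hδ, hw] at h5 ⊢
            linarith
        _ ≤ ENNReal.ofReal (∫ s, a * (w n s * |(g s).re| ^ p)) + ENNReal.ofReal (δ n) :=
            ENNReal.ofReal_add_le
        _ ≤ _ := by
            gcongr
            rw [ofReal_integral_eq_lintegral_ofReal ((hRi n).const_mul a)
              (Filter.Eventually.of_forall fun s => by have := hw0 n s; positivity)]
            refine lintegral_mono fun s => ENNReal.ofReal_le_ofReal ?_
            refine mul_le_mul_of_nonneg_left ?_ ha
            exact mul_le_of_le_one_left (by positivity) (hw1 n s)
    · simp only [h1]
      exact ((hRi n).const_mul a).sub ((hΦi n).const_mul b)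
    · exact Filter.Eventually.of_forall fun s => mul_nonneg (hw0 n s) (hab _)
  calc _ = ∫⁻ s : ℝ, Filter.liminf (fun n => ENNReal.ofReal
        (w n s * (a * |(g s).re| ^ p - b * foldedPow p (g s)))) Filter.atTop := by
        refine lintegral_congr fun s => ?_
        have := (ENNReal.continuous_ofReal.tendsto _).comp
          ((hwt s).mul_const (a * |(g s).re| ^ p - b * foldedPow p (g s)))
        rw [one_mul] at this
        exact this.liminf_eq.symm
    _ ≤ Filter.liminf (fun n => ∫⁻ s : ℝ, ENNReal.ofReal
        (w n s * (a * |(g s).re| ^ p - b * foldedPow p (g s)))) Filter.atTop := by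
        refine lintegral_liminf_le fun n => ?_
        refine ENNReal.measurable_ofReal.comp (Continuous.measurable ?_)
        refine Continuous.mul ?_ ((hRc.const_mul a).sub ((hΦ.comp hgr).const_mul b))
        exact continuous_const.div (by fun_prop) fun s => by positivity
    _ ≤ Filter.liminf (fun n => A + ENNReal.ofReal (δ n)) Filter.atTop :=
        Filter.liminf_le_liminf (Filter.Eventually.of_forall hstep)
    _ = A := by
        have h1 := (ENNReal.continuous_ofReal.tendsto _).comp hδt
        rw [ENNReal.ofReal_zero] at h1
        have h2 := (tendsto_const_nhds (x := A)).add h1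
        rw [add_zero] at h2
        exact h2.liminf_eq

lemma lintegral_eq_lintegral_line {d : ℕ} {θ : EuclideanSpace ℝ (Fin d)} (hθ : ‖θ‖ = 1)
    {k : ℝ → ENNReal} (hk : Measurable k) (hk1 : ∫⁻ s, k s = 1)
    {h : EuclideanSpace ℝ (Fin d) → ENNReal} (hh : Measurable h) :
    ∫⁻ x, h x = ∫⁻ x, k (inner ℝ x θ) * ∫⁻ s : ℝ, h (x + s • θ) := by
  have hmeas : Measurable fun q : EuclideanSpace ℝ (Fin d) × ℝ => h (q.1 + q.2 • θ) :=
    hh.comp (by fun_prop)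
  have hkmeas : Measurable fun q : EuclideanSpace ℝ (Fin d) × ℝ =>
      k (inner ℝ q.1 θ) * h (q.1 + q.2 • θ) :=
    (hk.comp (by fun_prop)).mul hmeas
  have hkmeas2 : Measurable fun q : ℝ × EuclideanSpace ℝ (Fin d) =>
      k (inner ℝ q.2 θ - q.1) * h q.2 :=
    (hk.comp (by fun_prop)).mul (hh.comp measurable_snd)
  have h1 : ∀ x, k (inner ℝ x θ) * ∫⁻ s : ℝ, h (x + s • θ)
      = ∫⁻ s : ℝ, k (inner ℝ x θ) * h (x + s • θ) := by
    intro x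
    have hx : Measurable fun s : ℝ => h (x + s • θ) := hmeas.comp measurable_prodMk_left
    rw [lintegral_const_mul _ hx]
  have h2 : ∀ s : ℝ, ∫⁻ x, k (inner ℝ x θ) * h (x + s • θ)
      = ∫⁻ x, k (inner ℝ x θ - s) * h x := by
    intro s
    rw [← lintegral_add_right_eq_self (fun x => k (inner ℝ x θ - s) * h x) (s • θ)]
    refine lintegral_congr fun x => ?_
    rw [inner_add_left, real_inner_smul_left, real_inner_self_eq_norm_sq, hθ, one_pow, mul_one,
      add_sub_cancel_right]
  rw [lintegral_congr h1, lintegral_lintegral_swap hkmeas.aemeasurable, lintegral_congr h2,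
    lintegral_lintegral_swap hkmeas2.aemeasurable]
  refine lintegral_congr fun x => ?_
  have hx : Measurable fun s : ℝ => k (inner ℝ x θ - s) := hk.comp (by fun_prop)
  rw [lintegral_mul_const _ hx, lintegral_sub_left_eq_self k, hk1, one_mul]

lemma lintegral_exp_neg_mul_abs_add {Y : ℝ} (hY : 0 < Y) (a : ℝ) :
    ∫⁻ s : ℝ, ENNReal.ofReal (exp (-(2 * π * Y * |a + s|))) = ENNReal.ofReal (1 / (π * Y)) := by
  have hπ := pi_pos
  rw [lintegral_add_left_eq_self (fun s => ENNReal.ofReal (exp (-(2 * π * Y * |s|)))) a]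
  have hv : ∫ s : ℝ, exp (-(2 * π * Y * |s|)) = 1 / (π * Y) := by
    rw [integral_comp_abs (f := fun s => exp (-(2 * π * Y * s)))]
    simp only [← neg_mul]
    rw [integral_exp_mul_Ioi (by simp only [neg_mul, Left.neg_neg_iff]; positivity)]
    simp only [mul_zero, exp_zero]
    field_simp
  have hi : Integrable fun s : ℝ => exp (-(2 * π * Y * |s|)) :=
    .of_integral_ne_zero (by rw [hv]; positivity)
  rw [← ofReal_integral_eq_lintegral_ofReal hi
    (Filter.Eventually.of_forall fun s => (exp_pos _).le), hv]

lemma exists_integral_exp_le {d : ℕ} (F : SchwartzMap (EuclideanSpace ℝ (Fin d)) ℂ)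
    {θ : EuclideanSpace ℝ (Fin d)} (hθ : ‖θ‖ = 1) : ∃ C : ℝ, ∀ Y : ℝ, 0 < Y →
    ∫ ξ, ‖F ξ‖ * exp (-(2 * π * Y * |inner ℝ ξ θ|)) ≤ C / Y := by
  have hπ := pi_pos
  obtain ⟨K, hK⟩ : ∃ K : ℝ, ∀ x, (1 + ‖x‖) ^ (d + 1) * ‖F x‖ ≤ K := by
    refine ⟨2 ^ (d + 1) * (Finset.Iic (d + 1, 0)).sup
      (fun m => SchwartzMap.seminorm ℝ m.1 m.2) F, fun x => ?_⟩
    have h := SchwartzMap.one_add_le_sup_seminorm_apply (𝕜 := ℝ) (m := (d + 1, 0)) le_rfl le_rfl F x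
    rw [norm_iteratedFDeriv_zero] at h
    exact h
  have hK0 : 0 ≤ K := le_trans (by positivity) (hK 0)
  set J := ∫⁻ x : EuclideanSpace ℝ (Fin d), ENNReal.ofReal ((1 + ‖x‖) ^ (-((d : ℝ) + 1))) with hJ
  have hJ' : J < ⊤ := by
    have := integrable_one_add_norm (E := EuclideanSpace ℝ (Fin d)) (μ := volume)
      (r := (d : ℝ) + 1) (by simp)
    exact this.lintegral_lt_top
  refine ⟨K * 2 ^ (d + 1) * J.toReal / π, fun Y hY => ?_⟩
  have hpt : ∀ x : EuclideanSpace ℝ (Fin d), inner ℝ x θ ∈ Set.Ico (0 : ℝ) 1 → ∀ s : ℝ,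
      ‖F (x + s • θ)‖ ≤ K * 2 ^ (d + 1) * (1 + ‖x‖) ^ (-((d : ℝ) + 1)) := by
    intro x hx s
    have h1 : ‖x + s • θ‖ ^ 2 = ‖x‖ ^ 2 + 2 * (s * inner ℝ x θ) + s ^ 2 := by
      rw [norm_add_sq_real, real_inner_smul_right, norm_smul, hθ, mul_one, norm_eq_abs, sq_abs]
    have h2 : ‖x‖ ^ 2 ≤ ‖x + s • θ‖ ^ 2 + 1 := by
      rw [h1]; nlinarith [sq_nonneg (s + inner ℝ x θ), hx.1, hx.2]
    have h3 : 1 + ‖x‖ ≤ 2 * (1 + ‖x + s • θ‖) := by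
      nlinarith [norm_nonneg x, norm_nonneg (x + s • θ)]
    have h4 := hK (x + s • θ)
    have h5 : (1 + ‖x‖) ^ (-((d : ℝ) + 1)) = ((1 + ‖x‖) ^ (d + 1))⁻¹ := by
      rw [rpow_neg (by positivity), ← rpow_natCast]; push_cast; rfl
    have h6 : (1 + ‖x‖) ^ (d + 1) ≤ 2 ^ (d + 1) * (1 + ‖x + s • θ‖) ^ (d + 1) := by
      rw [← mul_pow]; exact pow_le_pow_left₀ (by positivity) h3 _
    rw [h5, ← div_eq_mul_inv, le_div_iff₀ (by positivity)]
    calc _ ≤ ‖F (x + s • θ)‖ * (2 ^ (d + 1) * (1 + ‖x + s • θ‖) ^ (d + 1)) := by gcongr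
      _ = 2 ^ (d + 1) * ((1 + ‖x + s • θ‖) ^ (d + 1) * ‖F (x + s • θ)‖) := by ring
      _ ≤ 2 ^ (d + 1) * K := by gcongr
      _ = _ := by ring
  have hcont : Continuous fun ξ => ‖F ξ‖ * exp (-(2 * π * Y * |inner ℝ ξ θ|)) := by
    have := F.continuous
    fun_prop
  rw [integral_eq_lintegral_of_nonneg_ae (Filter.Eventually.of_forall fun ξ => by positivity)
    hcont.aestronglyMeasurable]
  have hrhs : 0 ≤ K * 2 ^ (d + 1) * J.toReal / π / Y := by positivity
  refine ENNReal.toReal_le_of_le_ofReal hrhs ?_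
  have hk1 : ∫⁻ s, (Set.Ico (0 : ℝ) 1).indicator (fun _ => (1 : ENNReal)) s = 1 := by
    rw [lintegral_indicator measurableSet_Ico]; simp
  rw [lintegral_eq_lintegral_line (h := fun ξ =>
    ENNReal.ofReal (‖F ξ‖ * exp (-(2 * π * Y * |inner ℝ ξ θ|)))) hθ
    (measurable_const.indicator measurableSet_Ico) hk1
    (ENNReal.measurable_ofReal.comp hcont.measurable)]
  calc _ ≤ ∫⁻ x : EuclideanSpace ℝ (Fin d),
        ENNReal.ofReal (K * 2 ^ (d + 1) * (1 + ‖x‖) ^ (-((d : ℝ) + 1)) * (1 / (π * Y))) := by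
        refine lintegral_mono fun x => ?_
        by_cases hx : inner ℝ x θ ∈ Set.Ico (0 : ℝ) 1
        swap
        · rw [Set.indicator_of_notMem hx, zero_mul]; exact zero_le
        rw [Set.indicator_of_mem hx, one_mul, ENNReal.ofReal_mul (by positivity),
          ← lintegral_exp_neg_mul_abs_add hY (inner ℝ x θ),
          ← lintegral_const_mul _ (by fun_prop)]
        refine lintegral_mono fun s => ?_
        rw [← ENNReal.ofReal_mul (by positivity)]
        apply ENNReal.ofReal_le_ofReal
        rw [inner_add_left, real_inner_smul_left, real_inner_self_eq_norm_sq, hθ, one_pow, mul_one]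
        gcongr
        exact hpt x hx s
    _ = ENNReal.ofReal (K * 2 ^ (d + 1) / (π * Y)) * J := by
        rw [hJ, ← lintegral_const_mul' _ _ ENNReal.ofReal_ne_top]
        refine lintegral_congr fun x => ?_
        rw [← ENNReal.ofReal_mul (by positivity)]
        congr 1
        ring
    _ = ENNReal.ofReal (K * 2 ^ (d + 1) / (π * Y)) * ENNReal.ofReal J.toReal := by
        rw [ENNReal.ofReal_toReal hJ'.ne]
    _ = _ := by
        rw [← ENNReal.ofReal_mul (by positivity)]
        congr 1
        field_simp

lemma norm_exp_two_pi_mul (z : ℂ) (τ : ℝ) :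
    ‖Complex.exp (2 * π * Complex.I * z * τ)‖ = exp (-(2 * π * z.im * τ)) := by
  rw [Complex.norm_exp]
  congr 1
  simp

lemma continuousOn_integral_exp {α : Type*} [MeasurableSpace α] {μ : Measure α} {a : α → ℂ}
    {τ : α → ℝ} (ha : Integrable a μ) (hτm : Measurable τ) (hτ : ∀ ξ, 0 ≤ τ ξ) :
    ContinuousOn (fun z : ℂ => ∫ ξ, a ξ * Complex.exp (2 * π * Complex.I * z * τ ξ) ∂μ)
      {z | 0 ≤ z.im} := by
  refine continuousOn_of_dominated (bound := fun ξ => ‖a ξ‖) (fun z _ => ?_) (fun z hz => ?_)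
    ha.norm (Filter.Eventually.of_forall fun ξ => ?_)
  · exact ha.aestronglyMeasurable.mul (by fun_prop : Measurable _).aestronglyMeasurable
  · refine Filter.Eventually.of_forall fun ξ => ?_
    rw [norm_mul, norm_exp_two_pi_mul]
    refine mul_le_of_le_one_right (norm_nonneg _) (exp_le_one_iff.2 ?_)
    have := hτ ξ
    have hz' : 0 ≤ z.im := hz
    have := pi_pos
    simp only [Left.neg_nonpos_iff]
    positivity
  · fun_prop

lemma differentiableOn_integral_exp {α : Type*} [MeasurableSpace α] {μ : Measure α} {a : α → ℂ}
    {τ : α → ℝ} (ha : Integrable a μ) (hτm : Measurable τ) (hτ : ∀ ξ, 0 ≤ τ ξ)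
    (haτ : Integrable (fun ξ => τ ξ * ‖a ξ‖) μ) :
    DifferentiableOn ℂ (fun z : ℂ => ∫ ξ, a ξ * Complex.exp (2 * π * Complex.I * z * τ ξ) ∂μ)
      {z | 0 < z.im} := by
  intro z hz
  have hopen : IsOpen {z : ℂ | 0 < z.im} := isOpen_lt continuous_const Complex.continuous_im
  have hbd : ∀ ξ, ∀ w : ℂ, 0 ≤ w.im →
      ‖Complex.exp (2 * π * Complex.I * w * τ ξ)‖ ≤ 1 := by
    intro ξ w hw
    rw [norm_exp_two_pi_mul]
    refine exp_le_one_iff.2 ?_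
    have := hτ ξ
    have := pi_pos
    simp only [Left.neg_nonpos_iff]
    positivity
  refine DifferentiableAt.differentiableWithinAt (HasDerivAt.differentiableAt
    (hasDerivAt_integral_of_dominated_loc_of_deriv_le
    (F' := fun w ξ => a ξ * (Complex.exp (2 * π * Complex.I * w * τ ξ) *
      (2 * π * Complex.I * τ ξ)))
    (bound := fun ξ => 2 * π * (τ ξ * ‖a ξ‖)) (hopen.mem_nhds hz)
    (Filter.Eventually.of_forall fun w => ?_) ?_ ?_ ?_ (haτ.const_mul _) ?_).2)
  · exact ha.aestronglyMeasurable.mul (by fun_prop : Measurable _).aestronglyMeasurable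
  · refine ha.norm.mono (ha.aestronglyMeasurable.mul
      (by fun_prop : Measurable _).aestronglyMeasurable) (Filter.Eventually.of_forall fun ξ => ?_)
    rw [norm_mul, norm_norm]
    exact mul_le_of_le_one_right (norm_nonneg _) (hbd ξ z (le_of_lt hz))
  · exact ha.aestronglyMeasurable.mul (by fun_prop : Measurable _).aestronglyMeasurable
  · refine Filter.Eventually.of_forall fun ξ w hw => ?_
    have h1 := hbd ξ w (le_of_lt hw)
    have h2 : ‖(2 * π * Complex.I * τ ξ : ℂ)‖ = 2 * π * τ ξ := by
      simp [abs_of_nonneg (hτ ξ), abs_of_pos pi_pos]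
    rw [norm_mul, norm_mul, h2]
    have := hτ ξ
    have := pi_pos
    calc _ ≤ ‖a ξ‖ * (1 * (2 * π * τ ξ)) := by gcongr
      _ = _ := by ring
  · refine Filter.Eventually.of_forall fun ξ w hw => ?_
    have h : HasDerivAt (fun w : ℂ => 2 * π * Complex.I * w * τ ξ)
        (2 * π * Complex.I * τ ξ) w := by
      simpa using ((hasDerivAt_id w).const_mul (2 * π * Complex.I)).mul_const (τ ξ : ℂ)
    exact h.cexp.const_mul (a ξ)

@[irreducible]
noncomputable def directionalHilbert {d : ℕ} (F : EuclideanSpace ℝ (Fin d) → ℂ)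
    (θ x : EuclideanSpace ℝ (Fin d)) : ℂ :=
  ∫ ξ, (if 0 < inner ℝ ξ θ then -Complex.I else Complex.I) *
    (𝐞 (inner ℝ ξ x) • F ξ)

lemma measurable_directionalHilbert {d : ℕ} {F : EuclideanSpace ℝ (Fin d) → ℂ}
    (hF : Measurable F) :
    Measurable fun q : EuclideanSpace ℝ (Fin d) × EuclideanSpace ℝ (Fin d) =>
      directionalHilbert F q.1 q.2 := by
  unfold directionalHilbert
  refine StronglyMeasurable.measurable (StronglyMeasurable.integral_prod_right (f :=
    fun (q : EuclideanSpace ℝ (Fin d) × EuclideanSpace ℝ (Fin d)) ξ =>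
      (if 0 < inner ℝ ξ q.1 then -Complex.I else Complex.I) * (𝐞 (inner ℝ ξ q.2) • F ξ)) ?_)
  refine Measurable.stronglyMeasurable ?_
  refine Measurable.mul (Measurable.ite (measurableSet_lt measurable_const (by fun_prop))
    measurable_const measurable_const) ?_
  simp only [Circle.smul_def, smul_eq_mul]
  refine Measurable.mul ?_ (hF.comp measurable_snd)
  have : Continuous fun q : (EuclideanSpace ℝ (Fin d) × EuclideanSpace ℝ (Fin d)) ×
      EuclideanSpace ℝ (Fin d) => (𝐞 (inner ℝ q.2 q.1.2) : ℂ) := by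
    refine continuous_subtype_val.comp (continuous_fourierChar.comp (by fun_prop))
  exact this.measurable

lemma exists_halfPlane_extension {d : ℕ} (F : SchwartzMap (EuclideanSpace ℝ (Fin d)) ℂ)
    {θ : EuclideanSpace ℝ (Fin d)} (hθ : ‖θ‖ = 1) (x : EuclideanSpace ℝ (Fin d)) :
    ∃ (g : ℂ → ℂ) (M C : ℝ), ContinuousOn g {z | 0 ≤ z.im} ∧
      DifferentiableOn ℂ g {z | 0 < z.im} ∧ (∀ z, 0 ≤ z.im → ‖g z‖ ≤ M) ∧
      (∀ Y : ℝ, 0 < Y → ‖g (Y * Complex.I)‖ ≤ C / Y) ∧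
      ∀ s : ℝ, g s = ⟨(𝓕⁻ (F : EuclideanSpace ℝ (Fin d) → ℂ) (x + s • θ)).re,
        (directionalHilbert F θ (x + s • θ)).re⟩ := by
  set τ : EuclideanSpace ℝ (Fin d) → ℝ := fun ξ => |inner ℝ ξ θ| with hτdef
  set a : EuclideanSpace ℝ (Fin d) → ℂ := fun ξ => if 0 < inner ℝ ξ θ then
    𝐞 (inner ℝ ξ x) • F ξ else (starRingEnd ℂ) (𝐞 (inner ℝ ξ x) • F ξ) with hadef
  have hFc := F.continuous
  have hchar : ∀ y : EuclideanSpace ℝ (Fin d), Continuous fun ξ : EuclideanSpace ℝ (Fin d) =>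
      (𝐞 (inner ℝ ξ y) • F ξ : ℂ) := fun y =>
    (continuous_fourierChar.comp (by fun_prop : Continuous fun ξ => inner ℝ ξ y)).smul hFc
  have hset : MeasurableSet {ξ : EuclideanSpace ℝ (Fin d) | 0 < inner ℝ ξ θ} :=
    measurableSet_lt measurable_const (by fun_prop)
  have ham : Measurable a := Measurable.ite hset (hchar x).measurable
    ((Complex.continuous_conj.comp (hchar x)).measurable)
  have han : ∀ ξ, ‖a ξ‖ = ‖F ξ‖ := by
    intro ξ
    simp only [hadef]
    split_ifs <;> simp
  have hτm : Measurable τ := by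
    have : Continuous τ := by simp only [hτdef]; fun_prop
    exact this.measurable
  have hai : Integrable a :=
    F.integrable.mono ham.aestronglyMeasurable (Filter.Eventually.of_forall fun ξ => (han ξ).le)
  have hτ0 : ∀ ξ, 0 ≤ τ ξ := fun ξ => abs_nonneg _
  have hτa : Integrable fun ξ => τ ξ * ‖a ξ‖ := by
    refine (F.integrable_pow_mul volume 1).mono
      (hτm.mul ham.norm).aestronglyMeasurable (Filter.Eventually.of_forall fun ξ => ?_)
    rw [han, norm_mul, norm_mul, pow_one, norm_norm, norm_norm]
    gcongr
    simp only [hτdef, norm_eq_abs, abs_abs]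
    have := abs_real_inner_le_norm ξ θ
    rwa [hθ, mul_one] at this
  obtain ⟨C, hC⟩ := exists_integral_exp_le F hθ
  refine ⟨fun z => ∫ ξ, a ξ * Complex.exp (2 * π * Complex.I * z * τ ξ), ∫ ξ, ‖F ξ‖, C,
    continuousOn_integral_exp hai hτm hτ0, differentiableOn_integral_exp hai hτm hτ0 hτa,
    fun z hz => ?_, fun Y hY => ?_, fun s => ?_⟩
  · refine norm_integral_le_of_norm_le F.integrable.norm (Filter.Eventually.of_forall fun ξ => ?_)
    rw [norm_mul, norm_exp_two_pi_mul, han]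
    refine mul_le_of_le_one_right (norm_nonneg _) (exp_le_one_iff.2 ?_)
    have := hτ0 ξ
    have := pi_pos
    simp only [Left.neg_nonpos_iff]
    positivity
  · refine (norm_integral_le_integral_norm _).trans ((le_of_eq ?_).trans (hC Y hY))
    refine integral_congr_ae (Filter.Eventually.of_forall fun ξ => ?_)
    simp only [norm_mul, norm_exp_two_pi_mul, han]
    simp [hτdef]
  · have hw : ∀ ξ, (𝐞 (inner ℝ ξ (x + s • θ)) : ℂ) = 𝐞 (inner ℝ ξ x) *
        Complex.exp (2 * π * Complex.I * s * inner ℝ ξ θ) := by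
      intro ξ
      rw [fourierChar_apply, fourierChar_apply, ← Complex.exp_add, inner_add_right,
        real_inner_smul_right]
      congr 1
      push_cast
      ring
    have hg : ∀ ξ, a ξ * Complex.exp (2 * π * Complex.I * s * τ ξ) =
        ⟨(𝐞 (inner ℝ ξ (x + s • θ)) • F ξ : ℂ).re,
          ((if 0 < inner ℝ ξ θ then -Complex.I else Complex.I) *
            (𝐞 (inner ℝ ξ (x + s • θ)) • F ξ)).re⟩ := by
      intro ξ
      simp only [Circle.smul_def, smul_eq_mul, hw, hadef, hτdef]
      split_ifs with h
      · rw [abs_of_pos h]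
        apply Complex.ext
        · simp only; congr 1; ring
        · rw [mul_right_comm]; simp
      · rw [abs_of_nonpos (not_lt.1 h)]
        have he : Complex.exp (2 * π * Complex.I * s * (-inner ℝ ξ θ : ℝ)) =
            (starRingEnd ℂ) (Complex.exp (2 * π * Complex.I * s * inner ℝ ξ θ)) := by
          have h2 : (starRingEnd ℂ) 2 = 2 := Complex.conj_ofNat 2
          rw [← Complex.exp_conj]
          simp [h2]
        rw [he, ← map_mul, mul_right_comm]
        apply Complex.ext
        · rw [Complex.conj_re]
        · rw [Complex.conj_im]; simp
    have hi1 : Integrable fun ξ => (𝐞 (inner ℝ ξ (x + s • θ)) • F ξ : ℂ) :=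
      F.integrable.mono (hchar _).aestronglyMeasurable
        (Filter.Eventually.of_forall fun ξ => by simp)
    have hi2 : Integrable fun ξ => (if 0 < inner ℝ ξ θ then -Complex.I else Complex.I) *
        (𝐞 (inner ℝ ξ (x + s • θ)) • F ξ : ℂ) :=
      hi1.mono ((Measurable.ite hset measurable_const
        measurable_const).mul (hchar _).measurable).aestronglyMeasurable
        (Filter.Eventually.of_forall fun ξ => by split_ifs <;> simp)
    have hi3 : Integrable fun ξ => a ξ * Complex.exp (2 * π * Complex.I * s * τ ξ) :=
      hai.mono (ham.mul (by fun_prop)).aestronglyMeasurable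
        (Filter.Eventually.of_forall fun ξ => by rw [norm_mul, norm_exp_two_pi_mul]; simp)
    apply Complex.ext
    · have := integral_re hi3
      have h2 := integral_re hi1
      simp only [RCLike.re_to_complex] at this h2
      simp only
      rw [← this, fourierInv_eq, ← h2]
      exact integral_congr_ae (Filter.Eventually.of_forall fun ξ => by simp only [hg])
    · have := integral_im hi3
      have h2 := integral_re hi2
      simp only [RCLike.re_to_complex, RCLike.im_to_complex] at this h2
      simp only [directionalHilbert]
      rw [← this, ← h2]
      exact integral_congr_ae (Filter.Eventually.of_forall fun ξ => by simp only [hg])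

lemma measurable_foldedPow_comp {α : Type*} [MeasurableSpace α] {p : ℝ} (hp : 0 < p)
    {u v : α → ℝ} (hu : Measurable u) (hv : Measurable v) :
    Measurable fun x => foldedPow p ⟨u x, v x⟩ := by
  have hpair : Measurable fun x => (⟨u x, v x⟩ : ℂ) :=
    Complex.measurableEquivRealProd.symm.measurable.comp (hu.prodMk hv)
  exact (continuous_foldedPow hp).measurable.comp hpair

lemma lintegral_directionalHilbert_le {d : ℕ} {p a b : ℝ} (hp1 : 1 < p) (hp2 : p < 2)
    (ha : 0 ≤ a) (hb : 0 ≤ b) (hab : ∀ w : ℂ, 0 ≤ a * |w.re| ^ p - b * foldedPow p w)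
    (F : SchwartzMap (EuclideanSpace ℝ (Fin d)) ℂ) {θ : EuclideanSpace ℝ (Fin d)} (hθ : ‖θ‖ = 1) :
    ∫⁻ x, ENNReal.ofReal (a * |(𝓕⁻ (F : EuclideanSpace ℝ (Fin d) → ℂ) x).re| ^ p -
        b * foldedPow p ⟨(𝓕⁻ (F : EuclideanSpace ℝ (Fin d) → ℂ) x).re,
          (directionalHilbert F θ x).re⟩) ≤
      ∫⁻ x, ENNReal.ofReal (a * |(𝓕⁻ (F : EuclideanSpace ℝ (Fin d) → ℂ) x).re| ^ p) := by
  have hp0 : 0 < p := by linarith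
  have hk1 : ∫⁻ s, (Set.Ico (0 : ℝ) 1).indicator (fun _ => (1 : ENNReal)) s = 1 := by
    rw [lintegral_indicator measurableSet_Ico]; simp
  have hkm : Measurable ((Set.Ico (0 : ℝ) 1).indicator (fun _ => (1 : ENNReal))) :=
    measurable_const.indicator measurableSet_Ico
  have hfm : Measurable fun x => (𝓕⁻ (F : EuclideanSpace ℝ (Fin d) → ℂ) x).re := by
    rw [← SchwartzMap.fourierInv_coe]
    exact (Complex.continuous_re.comp (𝓕⁻ F).continuous).measurable
  have hHm : Measurable fun x => (directionalHilbert F θ x).re :=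
    Complex.measurable_re.comp ((measurable_directionalHilbert
      F.continuous.measurable).of_uncurry_left (f := directionalHilbert F) (x := θ))
  have hum : Measurable fun x => a * |(𝓕⁻ (F : EuclideanSpace ℝ (Fin d) → ℂ) x).re| ^ p :=
    (hfm.abs.pow_const p).const_mul a
  have hΞm := (hum.sub ((measurable_foldedPow_comp hp0 hfm hHm).const_mul b)).ennreal_ofReal
  have h1 := lintegral_eq_lintegral_line hθ hkm hk1 hΞm
  have h2 := lintegral_eq_lintegral_line hθ hkm hk1 hum.ennreal_ofReal
  simp only [Pi.sub_apply] at h1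
  rw [h1, h2]
  refine lintegral_mono fun x => mul_le_mul_right ?_ _
  obtain ⟨g, M, C, hgc, hgd, hgM, hgC, hg⟩ := exists_halfPlane_extension F hθ x
  have := lintegral_le_of_holomorphic hp1 hp2 ha hb hab hgc hgd hgM hgC
  simpa only [hg] using this

lemma foldedPow_mk_neg (p u v : ℝ) : foldedPow p ⟨u, -v⟩ = foldedPow p ⟨u, v⟩ := by
  unfold foldedPow
  have h1 : (⟨|u|, -v⟩ : ℂ) = (starRingEnd ℂ) ⟨|u|, v⟩ := by
    apply Complex.ext <;> simp
  have h2 : (⟨|u|, v⟩ : ℂ).arg ≠ π := by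
    rw [Ne, Complex.arg_eq_pi_iff]
    rintro ⟨h, -⟩
    exact absurd h (not_lt.2 (abs_nonneg u))
  simp only [h1]
  rw [Complex.conj_cpow _ _ h2, Complex.conj_ofReal, Complex.conj_re]

lemma convexOn_neg_foldedPow_of_ne_zero {p u : ℝ} (hp1 : 1 < p) (hp2 : p < 2) (hu : u ≠ 0) :
    ConvexOn ℝ Set.univ fun v : ℝ => -foldedPow p ⟨u, v⟩ := by
  have hu' : 0 < |u| := abs_pos.2 hu
  have hmk : ∀ v : ℝ, (⟨|u|, v⟩ : ℂ) = |u| + v * Complex.I := fun v => by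
    apply Complex.ext <;> simp
  have hslit : ∀ v : ℝ, ((|u| : ℝ) + v * Complex.I : ℂ) ∈ Complex.slitPlane := fun v => by
    left; simpa using hu'
  have hlin : ∀ v : ℝ, HasDerivAt (fun v : ℝ => ((|u| : ℝ) + v * Complex.I : ℂ)) Complex.I v := by
    intro v
    simpa using ((Complex.ofRealCLM.hasDerivAt (x := v)).mul_const Complex.I).const_add
      ((|u| : ℝ) : ℂ)
  have hpow : ∀ (q : ℂ) (v : ℝ), HasDerivAt (fun v : ℝ => ((|u| : ℝ) + v * Complex.I : ℂ) ^ q)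
      (q * ((|u| : ℝ) + v * Complex.I : ℂ) ^ (q - 1) * Complex.I) v := fun q v => by
    have h := HasDerivAt.comp v (((hasDerivAt_id ((|u| : ℝ) + v * Complex.I : ℂ)).cpow_const
      (c := q)) (hslit v)) (hlin v)
    simp only [id, mul_one] at h
    exact h
  have hd1 : ∀ v : ℝ, HasDerivAt (fun v : ℝ => -foldedPow p ⟨u, v⟩)
      (-(p * ((|u| : ℝ) + v * Complex.I : ℂ) ^ ((p : ℂ) - 1) * Complex.I).re) v := by
    intro v
    simp only [foldedPow, hmk]
    exact (Complex.reCLM.hasFDerivAt.comp_hasDerivAt v (hpow p v)).neg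
  have hd2 : ∀ v : ℝ, HasDerivAt
      (fun v : ℝ => -(p * ((|u| : ℝ) + v * Complex.I : ℂ) ^ ((p : ℂ) - 1) * Complex.I).re)
      (p * (p - 1) * (((|u| : ℝ) + v * Complex.I : ℂ) ^ ((p : ℂ) - 1 - 1)).re) v := by
    intro v
    have h := (Complex.reCLM.hasFDerivAt.comp_hasDerivAt v
      (((hpow ((p : ℂ) - 1) v).const_mul (p : ℂ)).mul_const Complex.I)).neg
    have : (p * (((p : ℂ) - 1) * ((|u| : ℝ) + v * Complex.I : ℂ) ^ ((p : ℂ) - 1 - 1) *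
        Complex.I) * Complex.I) = -((p * (p - 1) : ℝ) *
          ((|u| : ℝ) + v * Complex.I : ℂ) ^ ((p : ℂ) - 1 - 1)) := by
      push_cast
      linear_combination (p * ((p : ℂ) - 1) *
        ((|u| : ℝ) + v * Complex.I : ℂ) ^ ((p : ℂ) - 1 - 1)) * Complex.I_mul_I
    rw [Complex.reCLM_apply, this, Complex.neg_re, Complex.re_ofReal_mul, neg_neg] at h
    exact h
  refine convexOn_univ_of_deriv2_nonneg (fun v => (hd1 v).differentiableAt) ?_ fun v => ?_
  · rw [funext fun v => (hd1 v).deriv]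
    exact fun v => (hd2 v).differentiableAt
  · rw [Function.iterate_succ, Function.iterate_one, Function.comp_apply,
      funext fun v => (hd1 v).deriv, (hd2 v).deriv]
    refine mul_nonneg (by nlinarith) ?_
    set w : ℂ := (|u| : ℝ) + v * Complex.I with hw
    have hw0 : w ≠ 0 := Complex.slitPlane_ne_zero (hslit v)
    have harg : |w.arg| ≤ π / 2 := by
      rw [Complex.abs_arg_le_pi_div_two_iff]
      simp [hw]
    have hq : ((p : ℂ) - 1 - 1) = ((p - 2 : ℝ) : ℂ) := by push_cast; ring
    rw [hq, Complex.cpow_ofReal_re]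
    refine mul_nonneg (rpow_nonneg (norm_nonneg _) _) (cos_nonneg_of_mem_Icc ?_)
    refine Set.mem_Icc.2 (abs_le.1 ?_)
    rw [abs_mul, abs_of_neg (by linarith : p - 2 < 0)]
    nlinarith [abs_nonneg w.arg]

lemma convexOn_neg_foldedPow {p : ℝ} (hp1 : 1 < p) (hp2 : p < 2) (u : ℝ) :
    ConvexOn ℝ Set.univ fun v : ℝ => -foldedPow p ⟨u, v⟩ := by
  have hc := continuous_foldedPow (p := p) (by linarith)
  refine ⟨convex_univ, fun x _ y _ α β hα hβ hαβ => ?_⟩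
  have hcont : ∀ v : ℝ, Continuous fun u : ℝ => -foldedPow p ⟨u, v⟩ := fun v =>
    (hc.comp (Complex.equivRealProdCLM.symm.continuous.comp
      (by fun_prop : Continuous fun u : ℝ => (u, v)))).neg
  have hcl : IsClosed {u : ℝ | -foldedPow p ⟨u, α • x + β • y⟩ ≤
      α • -foldedPow p ⟨u, x⟩ + β • -foldedPow p ⟨u, y⟩} :=
    isClosed_le (hcont _) (((hcont x).const_smul α).add ((hcont y).const_smul β))
  have hsub : ({0}ᶜ : Set ℝ) ⊆ {u : ℝ | -foldedPow p ⟨u, α • x + β • y⟩ ≤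
      α • -foldedPow p ⟨u, x⟩ + β • -foldedPow p ⟨u, y⟩} := fun u hu =>
    (convexOn_neg_foldedPow_of_ne_zero hp1 hp2 hu).2 trivial trivial hα hβ hαβ
  exact hcl.closure_subset_iff.2 hsub ((dense_compl_singleton (0 : ℝ)).closure_eq ▸ trivial)

lemma setIntegral_ball_comp_isometry {d : ℕ} (ρ : EuclideanSpace ℝ (Fin d) ≃ₗᵢ[ℝ]
    EuclideanSpace ℝ (Fin d)) (g : EuclideanSpace ℝ (Fin d) → ℝ) :
    ∫ θ in Metric.ball 0 1, g (ρ θ) = ∫ θ in Metric.ball 0 1, g θ := by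
  have h := (ρ.measurePreserving).setIntegral_preimage_emb
    ρ.toHomeomorph.measurableEmbedding g (Metric.ball 0 1)
  have hset : (ρ ⁻¹' Metric.ball 0 1) = Metric.ball (0 : EuclideanSpace ℝ (Fin d)) 1 := by
    ext x
    simp
  rwa [hset] at h

lemma inner_reflection_left {d : ℕ} (v θ η : EuclideanSpace ℝ (Fin d)) :
    inner ℝ ((ℝ ∙ η)ᗮ.reflection v) θ = inner ℝ v ((ℝ ∙ η)ᗮ.reflection θ) := by
  rw [← LinearIsometryEquiv.inner_map_map (ℝ ∙ η)ᗮ.reflection, Submodule.reflection_reflection]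

lemma integral_ball_abs_inner {d : ℕ} {v w : EuclideanSpace ℝ (Fin d)} (h : ‖v‖ = ‖w‖) :
    ∫ θ in Metric.ball (0 : EuclideanSpace ℝ (Fin d)) 1, |inner ℝ v θ| =
      ∫ θ in Metric.ball (0 : EuclideanSpace ℝ (Fin d)) 1, |inner ℝ w θ| := by
  have hr := Submodule.reflection_sub h
  rw [← setIntegral_ball_comp_isometry ((ℝ ∙ (v - w))ᗮ.reflection) (fun θ => |inner ℝ v θ|)]
  simp only [← inner_reflection_left, hr]

lemma integral_ball_inner_mul_sign_eq_zero {d : ℕ} {ξ η : EuclideanSpace ℝ (Fin d)}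
    (h : inner ℝ η ξ = 0) :
    ∫ θ in Metric.ball (0 : EuclideanSpace ℝ (Fin d)) 1,
      inner ℝ η θ * (if 0 < inner ℝ ξ θ then (1 : ℝ) else -1) = 0 := by
  have hη := Submodule.reflection_orthogonalComplement_singleton_eq_neg (𝕜 := ℝ) η
  have hξ : (ℝ ∙ η)ᗮ.reflection ξ = ξ := by
    apply Submodule.reflection_mem_subspace_eq_self
    rw [Submodule.mem_orthogonal_singleton_iff_inner_right]
    exact h
  have := setIntegral_ball_comp_isometry ((ℝ ∙ η)ᗮ.reflection)
    (fun θ => inner ℝ η θ * (if 0 < inner ℝ ξ θ then (1 : ℝ) else -1))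
  simp only [← inner_reflection_left, hη, hξ, inner_neg_left, neg_mul, integral_neg] at this
  linarith

lemma integrableOn_ball_mul_sign {d : ℕ} {g : EuclideanSpace ℝ (Fin d) → ℝ} (hg : Continuous g)
    (ξ : EuclideanSpace ℝ (Fin d)) :
    IntegrableOn (fun θ => g θ * (if 0 < inner ℝ ξ θ then (1 : ℝ) else -1))
      (Metric.ball 0 1) := by
  have h1 : IntegrableOn g (Metric.ball 0 1) :=
    (hg.continuousOn.integrableOn_compact (isCompact_closedBall 0 1)).mono_set
      Metric.ball_subset_closedBall
  refine Integrable.mono h1 (hg.measurable.mul (Measurable.ite (measurableSet_lt measurable_const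
    (by fun_prop)) measurable_const measurable_const)).aestronglyMeasurable
    (Filter.Eventually.of_forall fun θ => ?_)
  split_ifs <;> simp

lemma integral_ball_coord_mul_sign {d : ℕ} (j : Fin d) (ξ : EuclideanSpace ℝ (Fin d)) :
    ∫ θ in Metric.ball (0 : EuclideanSpace ℝ (Fin d)) 1,
      θ j * (if 0 < inner ℝ ξ θ then (1 : ℝ) else -1) =
      (∫ θ in Metric.ball (0 : EuclideanSpace ℝ (Fin d)) 1, |θ j|) * (ξ j / ‖ξ‖) := by
  set e : EuclideanSpace ℝ (Fin d) := EuclideanSpace.single j 1 with he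
  have hej : ∀ θ : EuclideanSpace ℝ (Fin d), inner ℝ e θ = θ j := fun θ => by
    simp [he, EuclideanSpace.inner_single_left]
  have hen : ‖e‖ = 1 := by simp [he]
  set η := e - (ξ j / ‖ξ‖ ^ 2) • ξ with hη
  have hηξ : inner ℝ η ξ = 0 := by
    rw [hη, inner_sub_left, real_inner_smul_left, hej, real_inner_self_eq_norm_sq]
    by_cases h0 : ξ = 0
    · simp [h0]
    · have := norm_ne_zero_iff.2 h0
      field_simp
      ring
  have hsplit : ∀ θ : EuclideanSpace ℝ (Fin d),
      θ j * (if 0 < inner ℝ ξ θ then (1 : ℝ) else -1) =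
      inner ℝ η θ * (if 0 < inner ℝ ξ θ then (1 : ℝ) else -1) +
        ξ j / ‖ξ‖ ^ 2 * |inner ℝ ξ θ| := by
    intro θ
    have : |inner ℝ ξ θ| = inner ℝ ξ θ * (if 0 < inner ℝ ξ θ then (1 : ℝ) else -1) := by
      split_ifs with h
      · rw [abs_of_pos h, mul_one]
      · rw [abs_of_nonpos (not_lt.1 h), mul_neg_one]
    rw [this, hη, inner_sub_left, real_inner_smul_left, hej]
    ring
  have hinteg : IntegrableOn (fun θ : EuclideanSpace ℝ (Fin d) => ξ j / ‖ξ‖ ^ 2 * |inner ℝ ξ θ|)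
      (Metric.ball 0 1) :=
    ((by fun_prop : Continuous fun θ : EuclideanSpace ℝ (Fin d) =>
      ξ j / ‖ξ‖ ^ 2 * |inner ℝ ξ θ|).continuousOn.integrableOn_compact
        (isCompact_closedBall 0 1)).mono_set Metric.ball_subset_closedBall
  have hnorm : ‖ξ‖ = ‖(‖ξ‖ • e)‖ := by rw [norm_smul, hen, norm_norm, mul_one]
  simp only [hsplit]
  rw [integral_add (integrableOn_ball_mul_sign (by fun_prop) ξ) hinteg,
    integral_ball_inner_mul_sign_eq_zero hηξ, zero_add, integral_const_mul,
    integral_ball_abs_inner hnorm]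
  simp only [real_inner_smul_left, hej, abs_mul, abs_norm, integral_const_mul]
  by_cases h0 : ξ = 0
  · simp [h0]
  · have := norm_ne_zero_iff.2 h0
    field_simp

lemma integral_ball_abs_coord_pos {d : ℕ} (j : Fin d) :
    0 < ∫ θ in Metric.ball (0 : EuclideanSpace ℝ (Fin d)) 1, |θ j| := by
  have hc : Continuous fun θ : EuclideanSpace ℝ (Fin d) => |θ j| := by fun_prop
  have hinteg : IntegrableOn (fun θ : EuclideanSpace ℝ (Fin d) => |θ j|) (Metric.ball 0 1) :=
    (hc.continuousOn.integrableOn_compact (isCompact_closedBall 0 1)).mono_set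
      Metric.ball_subset_closedBall
  rw [setIntegral_pos_iff_support_of_nonneg_ae (Filter.Eventually.of_forall fun θ => abs_nonneg _)
    hinteg]
  refine IsOpen.measure_pos volume (hc.isOpen_support.inter Metric.isOpen_ball)
    ⟨EuclideanSpace.single j (1 / 2), ?_, ?_⟩
  · simp
  · simp only [Metric.mem_ball, dist_zero_right, EuclideanSpace.single, PiLp.norm_single]
    norm_num

lemma rieszTransform_eq_integral_directionalHilbert {d : ℕ} (j : Fin d)
    (F : SchwartzMap (EuclideanSpace ℝ (Fin d)) ℂ) (x : EuclideanSpace ℝ (Fin d)) :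
    ((∫ θ in Metric.ball (0 : EuclideanSpace ℝ (Fin d)) 1, |θ j| : ℝ) : ℂ) *
      𝓕⁻ (fun ξ : EuclideanSpace ℝ (Fin d) => -Complex.I * (ξ j : ℂ) / (‖ξ‖ : ℂ) * F ξ) x =
    ∫ θ in Metric.ball (0 : EuclideanSpace ℝ (Fin d)) 1, (θ j : ℂ) * directionalHilbert F θ x := by
  have hFc := F.continuous
  have hchar : Continuous fun ξ : EuclideanSpace ℝ (Fin d) => (𝐞 (inner ℝ ξ x) • F ξ : ℂ) :=
    (continuous_fourierChar.comp (by fun_prop : Continuous fun ξ => inner ℝ ξ x)).smul hFc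
  have hi : Integrable (Function.uncurry fun ξ θ : EuclideanSpace ℝ (Fin d) =>
      ((θ j * (if 0 < inner ℝ ξ θ then (1 : ℝ) else -1) : ℝ) : ℂ) *
        (-Complex.I * (𝐞 (inner ℝ ξ x) • F ξ)))
      (volume.prod (volume.restrict (Metric.ball 0 1))) := by
    have hθ : Integrable (fun θ : EuclideanSpace ℝ (Fin d) => θ j)
        (volume.restrict (Metric.ball 0 1)) :=
      ((by fun_prop : Continuous fun θ : EuclideanSpace ℝ (Fin d) => θ j).continuousOn.integrableOn_compact
        (isCompact_closedBall 0 1)).mono_set Metric.ball_subset_closedBall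
    refine (F.integrable.norm.mul_prod hθ).mono (Measurable.aestronglyMeasurable ?_)
      (Filter.Eventually.of_forall fun q => ?_)
    · refine Measurable.mul (Complex.measurable_ofReal.comp (Measurable.mul ?_ (Measurable.ite
        (measurableSet_lt measurable_const ?_) measurable_const measurable_const)))
        (((hchar.measurable.comp measurable_fst)).const_mul (-Complex.I))
      · have : Continuous fun q : EuclideanSpace ℝ (Fin d) × EuclideanSpace ℝ (Fin d) => q.2 j := by
          fun_prop
        exact this.measurable
      · fun_prop
    · simp only [Function.uncurry]
      split_ifs <;> simp [mul_comm]
  have hswap := integral_integral_swap hi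
  rw [fourierInv_eq, ← integral_const_mul]
  calc _ = ∫ ξ, ∫ θ in Metric.ball (0 : EuclideanSpace ℝ (Fin d)) 1,
        ((θ j * (if 0 < inner ℝ ξ θ then (1 : ℝ) else -1) : ℝ) : ℂ) *
        (-Complex.I * (𝐞 (inner ℝ ξ x) • F ξ)) := by
        refine integral_congr_ae (Filter.Eventually.of_forall fun ξ => ?_)
        simp only
        rw [integral_mul_const, integral_complex_ofReal, integral_ball_coord_mul_sign]
        simp only [Circle.smul_def, smul_eq_mul]
        push_cast
        ring
    _ = _ := hswap
    _ = _ := by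
        refine integral_congr_ae (Filter.Eventually.of_forall fun θ => ?_)
        simp only [directionalHilbert]
        rw [← integral_const_mul]
        refine integral_congr_ae (Filter.Eventually.of_forall fun ξ => ?_)
        simp only
        split_ifs <;> simp

noncomputable def directionMeasure {d : ℕ} (j : Fin d) : Measure (EuclideanSpace ℝ (Fin d)) :=
  (volume.restrict (Metric.ball 0 1)).withDensity fun θ =>
    ENNReal.ofReal (|θ j| / ∫ θ in Metric.ball (0 : EuclideanSpace ℝ (Fin d)) 1, |θ j|)

lemma isProbabilityMeasure_directionMeasure {d : ℕ} (j : Fin d) :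
    IsProbabilityMeasure (directionMeasure j) := by
  have hc := integral_ball_abs_coord_pos j
  refine ⟨?_⟩
  have hinteg : IntegrableOn (fun θ : EuclideanSpace ℝ (Fin d) => |θ j|) (Metric.ball 0 1) :=
    ((by fun_prop : Continuous fun θ : EuclideanSpace ℝ (Fin d) =>
      |θ j|).continuousOn.integrableOn_compact
        (isCompact_closedBall 0 1)).mono_set Metric.ball_subset_closedBall
  rw [directionMeasure, withDensity_apply _ MeasurableSet.univ, Measure.restrict_univ,
    ← ofReal_integral_eq_lintegral_ofReal (hinteg.div_const _)
      (Filter.Eventually.of_forall fun θ => by positivity), integral_div, div_self hc.ne',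
    ENNReal.ofReal_one]

lemma norm_directionalHilbert_le {d : ℕ} (F : SchwartzMap (EuclideanSpace ℝ (Fin d)) ℂ)
    (θ x : EuclideanSpace ℝ (Fin d)) : ‖directionalHilbert F θ x‖ ≤ ∫ ξ, ‖F ξ‖ := by
  unfold directionalHilbert
  refine norm_integral_le_of_norm_le F.integrable.norm (Filter.Eventually.of_forall fun ξ => ?_)
  split_ifs <;> simp

lemma rieszTransform_re_eq {d : ℕ} (j : Fin d)
    (F : SchwartzMap (EuclideanSpace ℝ (Fin d)) ℂ) (x : EuclideanSpace ℝ (Fin d)) :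
    (𝓕⁻ (fun ξ : EuclideanSpace ℝ (Fin d) =>
      -Complex.I * (ξ j : ℂ) / (‖ξ‖ : ℂ) * F ξ) x).re =
    ∫ θ, (if 0 < θ j then 1 else -1) * (directionalHilbert F θ x).re ∂directionMeasure j := by
  have hc := integral_ball_abs_coord_pos j
  have h := rieszTransform_eq_integral_directionalHilbert j F x
  rw [directionMeasure, integral_withDensity_eq_integral_toReal_smul
    (by fun_prop) (Filter.Eventually.of_forall fun _ => ENNReal.ofReal_lt_top)]
  set c := ∫ θ in Metric.ball (0 : EuclideanSpace ℝ (Fin d)) 1, |θ j| with hcdef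
  have hHm : Measurable fun θ => directionalHilbert F θ x :=
    (measurable_directionalHilbert F.continuous.measurable).of_uncurry_right
      (f := directionalHilbert F) (y := x)
  have hθ : Integrable (fun θ : EuclideanSpace ℝ (Fin d) => θ j)
      (volume.restrict (Metric.ball 0 1)) :=
    ((by fun_prop : Continuous fun θ : EuclideanSpace ℝ (Fin d) =>
      θ j).continuousOn.integrableOn_compact
        (isCompact_closedBall 0 1)).mono_set Metric.ball_subset_closedBall
  have hi : Integrable (fun θ : EuclideanSpace ℝ (Fin d) => (θ j : ℂ) * directionalHilbert F θ x)
      (volume.restrict (Metric.ball 0 1)) := by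
    refine (hθ.norm.mul_const (∫ ξ, ‖F ξ‖)).mono
      (Measurable.mul (by fun_prop) hHm).aestronglyMeasurable
      (Filter.Eventually.of_forall fun θ => ?_)
    have h1 := norm_directionalHilbert_le F θ x
    have h2 : ‖(θ j : ℂ)‖ = ‖θ j‖ := Complex.norm_real _
    rw [norm_mul, h2, norm_mul, norm_norm]
    gcongr
    exact h1.trans (le_abs_self _)
  have h3 := congrArg Complex.re h
  have h4 := integral_re hi
  simp only [RCLike.re_to_complex] at h4
  rw [Complex.re_ofReal_mul, ← h4] at h3
  rw [← mul_right_inj' hc.ne', h3, ← integral_const_mul]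
  refine integral_congr_ae (Filter.Eventually.of_forall fun θ => ?_)
  simp only [Complex.re_ofReal_mul, smul_eq_mul]
  rw [ENNReal.toReal_ofReal (by positivity)]
  have h5 : |θ j| * (if 0 < θ j then 1 else -1) = θ j := by
    split_ifs with h
    · rw [abs_of_pos h, mul_one]
    · rw [abs_of_nonpos (not_lt.1 h)]; ring
  field_simp
  rw [mul_assoc, h5, mul_comm]

lemma directionalHilbert_smul {d : ℕ} (F : EuclideanSpace ℝ (Fin d) → ℂ) {r : ℝ} (hr : 0 < r)
    (θ x : EuclideanSpace ℝ (Fin d)) :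
    directionalHilbert F (r • θ) x = directionalHilbert F θ x := by
  unfold directionalHilbert
  simp only [real_inner_smul_right, mul_pos_iff_of_pos_left hr]

lemma ae_ne_zero_directionMeasure {d : ℕ} (j : Fin d) :
    ∀ᵐ θ ∂directionMeasure j, θ ≠ 0 := by
  have : Nonempty (Fin d) := ⟨j⟩
  have h : ∀ᵐ θ : EuclideanSpace ℝ (Fin d) ∂(volume.restrict (Metric.ball 0 1)), θ ≠ 0 :=
    compl_mem_ae_iff.2 (measure_singleton 0)
  exact (withDensity_absolutelyContinuous _ _).ae_le h

lemma lintegral_rieszTransform_le {d : ℕ} {p a b : ℝ} (hp1 : 1 < p) (hp2 : p < 2)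
    (ha : 0 ≤ a) (hb : 0 ≤ b) (hab : ∀ w : ℂ, 0 ≤ a * |w.re| ^ p - b * foldedPow p w)
    (j : Fin d) (F : SchwartzMap (EuclideanSpace ℝ (Fin d)) ℂ) {u v : EuclideanSpace ℝ (Fin d) → ℝ}
    (hu : u = fun x => (𝓕⁻ (F : EuclideanSpace ℝ (Fin d) → ℂ) x).re)
    (hv : v = fun x => (𝓕⁻ (fun ξ : EuclideanSpace ℝ (Fin d) =>
      -Complex.I * (ξ j : ℂ) / (‖ξ‖ : ℂ) * F ξ) x).re) :
    ∫⁻ x, ENNReal.ofReal (a * |u x| ^ p - b * foldedPow p ⟨u x, v x⟩) ≤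
      ∫⁻ x, ENNReal.ofReal (a * |u x| ^ p) := by
  have hp0 : 0 < p := by linarith
  have := isProbabilityMeasure_directionMeasure j
  have hHm := measurable_directionalHilbert F.continuous.measurable
  have hum : Measurable u := by
    rw [hu, ← SchwartzMap.fourierInv_coe]
    exact (Complex.continuous_re.comp (𝓕⁻ F).continuous).measurable
  have hjensen : ∀ x, ENNReal.ofReal (a * |u x| ^ p - b * foldedPow p ⟨u x, v x⟩) ≤
      ∫⁻ θ, ENNReal.ofReal (a * |u x| ^ p -
        b * foldedPow p ⟨u x, (directionalHilbert F θ x).re⟩) ∂directionMeasure j := by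
    intro x
    have hHx : Measurable fun θ => directionalHilbert F θ x :=
      hHm.of_uncurry_right (f := directionalHilbert F) (y := x)
    set ψ : ℝ → ℝ := fun r => a * |u x| ^ p - b * foldedPow p ⟨u x, r⟩ with hψ
    have hψc : Continuous ψ := by
      have : Continuous fun r : ℝ => foldedPow p ⟨u x, r⟩ :=
        (continuous_foldedPow hp0).comp (Complex.equivRealProdCLM.symm.continuous.comp
          (by fun_prop : Continuous fun r : ℝ => (u x, r)))
      fun_prop
    have hψconv : ConvexOn ℝ Set.univ ψ := by
      have := ((convexOn_neg_foldedPow hp1 hp2 (u x)).smul hb).add_const (a * |u x| ^ p)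
      refine this.congr fun r _ => ?_
      simp only [hψ, Pi.add_apply, smul_eq_mul]
      ring
    have hψ0 : ∀ r, 0 ≤ ψ r := fun r => hab ⟨u x, r⟩
    have hψeven : ∀ r, ψ (-r) = ψ r := fun r => by simp only [hψ, foldedPow_mk_neg]
    set h : EuclideanSpace ℝ (Fin d) → ℝ := fun θ =>
      (if 0 < θ j then 1 else -1) * (directionalHilbert F θ x).re with hh
    have hψh : ∀ θ, ψ (h θ) = ψ (directionalHilbert F θ x).re := by
      intro θ
      simp only [hh]
      split_ifs
      · rw [one_mul]
      · rw [neg_one_mul, hψeven]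
    have hhm : Measurable h :=
      (Measurable.ite (measurableSet_lt measurable_const (by fun_prop)) measurable_const
        measurable_const).mul (Complex.measurable_re.comp hHx)
    have hhb : ∀ θ, ‖h θ‖ ≤ ∫ ξ, ‖F ξ‖ := by
      intro θ
      refine le_trans ?_ ((Complex.abs_re_le_norm _).trans (norm_directionalHilbert_le F θ x))
      simp only [hh]
      split_ifs <;> simp
    obtain ⟨K, hK⟩ := (isCompact_Icc (a := -∫ ξ, ‖F ξ‖)
      (b := ∫ ξ, ‖F ξ‖)).exists_bound_of_continuousOn hψc.continuousOn
    have hψi : Integrable (ψ ∘ h) (directionMeasure j) :=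
      Integrable.of_bound (hψc.measurable.comp hhm).aestronglyMeasurable K
        (Filter.Eventually.of_forall fun θ => hK _ (abs_le.1 (hhb θ)))
    have hj := hψconv.map_integral_le hψc.continuousOn isClosed_univ
      (Filter.Eventually.of_forall fun _ => Set.mem_univ _)
      (Integrable.of_bound hhm.aestronglyMeasurable _ (Filter.Eventually.of_forall hhb)) hψi
    have hvx : v x = ∫ θ, h θ ∂directionMeasure j := by
      rw [hv]; exact rieszTransform_re_eq j F x
    change ENNReal.ofReal (ψ (v x)) ≤ _
    rw [hvx]
    refine (ENNReal.ofReal_le_ofReal hj).trans (le_of_eq ?_)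
    have h2 := ofReal_integral_eq_lintegral_ofReal hψi
      (Filter.Eventually.of_forall fun θ => hψ0 _)
    simp only [Function.comp_apply] at h2
    rw [h2]
    simp only [hψh]
    rfl
  refine (lintegral_mono hjensen).trans ?_
  have hfm : Measurable fun q : EuclideanSpace ℝ (Fin d) × EuclideanSpace ℝ (Fin d) =>
      (directionalHilbert F q.2 q.1).re :=
    Complex.measurable_re.comp (Measurable.comp (g := fun q : EuclideanSpace ℝ (Fin d) ×
      EuclideanSpace ℝ (Fin d) => directionalHilbert F q.1 q.2) hHm measurable_swap)
  have hum1 : Measurable fun q : EuclideanSpace ℝ (Fin d) × EuclideanSpace ℝ (Fin d) => u q.1 :=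
    hum.comp measurable_fst
  have hGm := (((hum1.abs.pow_const p).const_mul a).sub
    ((measurable_foldedPow_comp hp0 hum1 hfm).const_mul b)).ennreal_ofReal
  simp only [Pi.sub_apply] at hGm
  rw [lintegral_lintegral_swap hGm.aemeasurable]
  calc _ ≤ ∫⁻ _ : EuclideanSpace ℝ (Fin d), (∫⁻ x, ENNReal.ofReal (a * |u x| ^ p))
        ∂directionMeasure j := by
        refine lintegral_mono_ae ?_
        filter_upwards [ae_ne_zero_directionMeasure j] with θ hθ
        have hn : 0 < ‖θ‖ := norm_pos_iff.2 hθ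
        have h := lintegral_directionalHilbert_le hp1 hp2 ha hb hab F
          (θ := ‖θ‖⁻¹ • θ) (by rw [norm_smul, norm_inv, norm_norm, inv_mul_cancel₀ hn.ne'])
        simp only [directionalHilbert_smul _ (inv_pos.2 hn)] at h
        simpa only [hu] using h
    _ = _ := by rw [lintegral_const, measure_univ, mul_one]

noncomputable instance : MeasurableSpace Circle := borel Circle

instance : BorelSpace Circle := ⟨rfl⟩

lemma eLpNorm_ofReal_eq {α E : Type*} [MeasurableSpace α] [NormedAddCommGroup E] {μ : Measure α}
    {p : ℝ} (hp : 0 < p) (h : α → E) :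
    eLpNorm h (ENNReal.ofReal p) μ = (∫⁻ x, ENNReal.ofReal (‖h x‖ ^ p) ∂μ) ^ (1 / p) := by
  rw [eLpNorm_eq_lintegral_rpow_enorm_toReal (by simpa using hp) ENNReal.ofReal_ne_top,
    ENNReal.toReal_ofReal hp.le]
  congr 1
  refine lintegral_congr fun x => ?_
  rw [← ofReal_norm, ENNReal.ofReal_rpow_of_nonneg (norm_nonneg _) hp.le]

lemma eLpNorm_circle_re {q : ENNReal} (z : ℂ) :
    eLpNorm (fun c : Circle => |(c * z).re|) q Measure.haar =
      ENNReal.ofReal ‖z‖ * eLpNorm (fun c : Circle => |(c : ℂ).re|) q Measure.haar := by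
  obtain ⟨w, hw⟩ : ∃ w : Circle, z = ‖z‖ * w := by
    refine ⟨Circle.exp z.arg, ?_⟩
    rw [Circle.coe_exp, Complex.norm_mul_exp_arg_mul_I]
  have h1 : (fun c : Circle => |(c * z).re|) =
      ‖z‖ • ((fun c : Circle => |(c : ℂ).re|) ∘ fun c => c * w) := by
    ext c
    rw [Pi.smul_apply, Function.comp_apply, smul_eq_mul, Circle.coe_mul]
    conv_lhs => rw [hw]
    rw [mul_left_comm, Complex.re_ofReal_mul, abs_mul, abs_norm]
  have hm : AEStronglyMeasurable (fun c : Circle => |(c : ℂ).re|) Measure.haar :=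
    (by fun_prop : Continuous fun c : Circle => |(c : ℂ).re|).aestronglyMeasurable
  rw [h1, eLpNorm_const_smul, eLpNorm_comp_measurePreserving hm (measurePreserving_mul_right _ w),
    ← ofReal_norm, norm_norm]

lemma lintegral_circle_re_pos {p : ℝ} (hp : 0 < p) :
    0 < ∫⁻ c : Circle, ENNReal.ofReal (|(c : ℂ).re| ^ p) ∂Measure.haar := by
  have hc : Continuous fun c : Circle => ENNReal.ofReal (|(c : ℂ).re| ^ p) :=
    ENNReal.continuous_ofReal.comp ((by fun_prop : Continuous fun c : Circle =>
      |(c : ℂ).re|).rpow_const fun _ => Or.inr hp.le)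
  rw [lintegral_pos_iff_support hc.measurable]
  refine IsOpen.measure_pos _ hc.isOpen_support ⟨1, ?_⟩
  rw [Function.mem_support, Circle.coe_one, Complex.one_re, abs_one, one_rpow, ENNReal.ofReal_one]
  exact one_ne_zero

lemma lintegral_circle_re_lt_top {p : ℝ} (hp : 0 < p) :
    ∫⁻ c : Circle, ENNReal.ofReal (|(c : ℂ).re| ^ p) ∂Measure.haar < ⊤ := by
  refine lt_of_le_of_lt (lintegral_mono (g := fun _ => 1) fun c => ?_) (by simp)
  rw [← ENNReal.ofReal_one]
  refine ENNReal.ofReal_le_ofReal (rpow_le_one (abs_nonneg _) ?_ hp.le)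
  exact (Complex.abs_re_le_norm _).trans (Circle.norm_coe c).le

lemma lintegral_circle_re_mul {p : ℝ} (hp : 0 < p) (z : ℂ) :
    ∫⁻ c : Circle, ENNReal.ofReal (|(c * z).re| ^ p) ∂Measure.haar =
      ENNReal.ofReal (‖z‖ ^ p) *
        ∫⁻ c : Circle, ENNReal.ofReal (|(c : ℂ).re| ^ p) ∂Measure.haar := by
  have h := eLpNorm_circle_re (q := ENNReal.ofReal p) z
  simp only [eLpNorm_ofReal_eq hp, norm_eq_abs, abs_abs] at h
  have h2 := congrArg (fun y : ENNReal => y ^ p) h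
  rw [ENNReal.mul_rpow_of_nonneg _ _ hp.le, ← ENNReal.rpow_mul, ← ENNReal.rpow_mul,
    one_div_mul_cancel hp.ne', ENNReal.rpow_one, ENNReal.rpow_one,
    ENNReal.ofReal_rpow_of_nonneg (norm_nonneg _) hp.le] at h2
  exact h2

lemma ofReal_abs_sub_mul_le {a b : ℝ} (ha : 0 ≤ a) (hb : 0 ≤ b) {m X : ENNReal} (hm : m ≠ ⊤)
    (h1 : ENNReal.ofReal a * m ≤ X + ENNReal.ofReal b * m)
    (h2 : ENNReal.ofReal b * m ≤ X + ENNReal.ofReal a * m) :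
    ENNReal.ofReal |a - b| * m ≤ X := by
  rcases le_total a b with h | h
  · rw [abs_of_nonpos (by linarith), neg_sub, ENNReal.ofReal_sub _ ha, ENNReal.sub_mul
      fun _ _ => hm]
    exact tsub_le_iff_right.2 h2
  · rw [abs_of_nonneg (by linarith), ENNReal.ofReal_sub _ hb, ENNReal.sub_mul fun _ _ => hm]
    exact tsub_le_iff_right.2 h1

lemma ofReal_abs_norm_sub_rpow_le {p t : ℝ} (hp : 1 ≤ p) (ht : 0 ≤ t) (z w : ℂ) :
    ENNReal.ofReal (|‖w‖ - t * ‖z‖| ^ p) *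
        ∫⁻ c : Circle, ENNReal.ofReal (|(c : ℂ).re| ^ p) ∂Measure.haar ≤
      ∫⁻ c : Circle, ENNReal.ofReal (|(|(c * w).re| - t * |(c * z).re|)| ^ p) ∂Measure.haar := by
  have hp0 : 0 < p := by linarith
  have hq : 1 ≤ ENNReal.ofReal p := by simpa using hp
  have hm : eLpNorm (fun c : Circle => |(c : ℂ).re|) (ENNReal.ofReal p) Measure.haar ≠ ⊤ := by
    rw [eLpNorm_ofReal_eq hp0]
    simp only [norm_eq_abs, abs_abs]
    exact ENNReal.rpow_ne_top_of_nonneg (by positivity) (lintegral_circle_re_lt_top hp0).ne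
  have hcont : ∀ z : ℂ, AEStronglyMeasurable (fun c : Circle => |(c * z).re|) Measure.haar :=
    fun z => (by fun_prop : Continuous fun c : Circle => |(c * z).re|).aestronglyMeasurable
  have htz : eLpNorm (t • fun c : Circle => |(c * z).re|) (ENNReal.ofReal p) Measure.haar =
      ENNReal.ofReal (t * ‖z‖) *
        eLpNorm (fun c : Circle => |(c : ℂ).re|) (ENNReal.ofReal p) Measure.haar := by
    rw [eLpNorm_const_smul, eLpNorm_circle_re, ← ofReal_norm, norm_of_nonneg ht,
      ENNReal.ofReal_mul ht, mul_assoc]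
  have hadd : ∀ a b : Circle → ℝ, AEStronglyMeasurable a Measure.haar →
      AEStronglyMeasurable b Measure.haar →
      eLpNorm a (ENNReal.ofReal p) Measure.haar ≤ eLpNorm (a - b) (ENNReal.ofReal p) Measure.haar +
        eLpNorm b (ENNReal.ofReal p) Measure.haar := by
    intro a b ha hb
    have := eLpNorm_add_le (ha.sub hb) hb hq
    rwa [sub_add_cancel] at this
  have hmain := ofReal_abs_sub_mul_le (norm_nonneg w) (mul_nonneg ht (norm_nonneg z)) hm
    (X := eLpNorm ((fun c : Circle => |(c * w).re|) - t • fun c : Circle => |(c * z).re|)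
      (ENNReal.ofReal p) Measure.haar)
    (by
      rw [← htz, ← eLpNorm_circle_re]
      exact hadd _ _ (hcont w) ((hcont z).const_smul t))
    (by
      rw [← htz, ← eLpNorm_circle_re, eLpNorm_sub_comm]
      exact hadd _ _ ((hcont z).const_smul t) (hcont w))
  have h2 := ENNReal.rpow_le_rpow hmain hp0.le
  simp only [eLpNorm_ofReal_eq hp0, norm_eq_abs, abs_abs] at h2
  rw [ENNReal.mul_rpow_of_nonneg _ _ hp0.le, ← ENNReal.rpow_mul, ← ENNReal.rpow_mul,
    one_div_mul_cancel hp0.ne', ENNReal.rpow_one, ENNReal.rpow_one,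
    ENNReal.ofReal_rpow_of_nonneg (abs_nonneg _) hp0.le] at h2
  simpa using h2

lemma rpow_abs_sub_le {p t : ℝ} (hp1 : 1 < p) (hp2 : p < 2) (u v : ℝ) :
    |(|v| - t * |u|)| ^ p ≤ (‖(⟨u, v⟩ : ℂ)‖ ^ (p - 2) * (|v| - t * |u|) ^ 2) ^ (p / 2) *
      (|v| ^ p + |u| ^ p) ^ (1 - p / 2) := by
  set w : ℂ := ⟨u, v⟩ with hw
  have hwsq : ‖w‖ ^ 2 = v ^ 2 + u ^ 2 := by
    rw [← Complex.normSq_eq_norm_sq, Complex.normSq_apply]; simp [hw]; ring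
  by_cases h0 : w = 0
  · have hu : u = 0 := congrArg Complex.re h0
    have hv : v = 0 := congrArg Complex.im h0
    rw [hu, hv]
    simp only [abs_zero, mul_zero, sub_zero]
    rw [zero_rpow (by linarith)]
    positivity
  have hn : 0 < ‖w‖ := norm_pos_iff.2 h0
  have h1 : ‖w‖ ^ p ≤ |v| ^ p + |u| ^ p := by
    have := rpow_add_le_add_rpow (sq_nonneg |v|) (sq_nonneg |u|) (by linarith : 0 ≤ p / 2)
      (by linarith)
    have hc : ∀ r : ℝ, 0 ≤ r → (r ^ 2) ^ (p / 2) = r ^ p := fun r hr => by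
      rw [← rpow_natCast, ← rpow_mul hr]; congr 1; push_cast; ring
    rw [hc _ (abs_nonneg _), hc _ (abs_nonneg _), sq_abs, sq_abs, ← hwsq, hc _ hn.le] at this
    exact this
  have h2 : (‖w‖ ^ p) ^ (1 - p / 2) ≤ (|v| ^ p + |u| ^ p) ^ (1 - p / 2) :=
    rpow_le_rpow (by positivity) h1 (by linarith)
  have h3 : (‖w‖ ^ (p - 2) * (|v| - t * |u|) ^ 2) ^ (p / 2) =
      ‖w‖ ^ ((p - 2) * (p / 2)) * |(|v| - t * |u|)| ^ p := by
    rw [mul_rpow (by positivity) (by positivity), ← rpow_mul hn.le, ← sq_abs (|v| - t * |u|),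
      ← rpow_natCast, ← rpow_mul (abs_nonneg _)]
    congr 2
    push_cast; ring
  have h4 : ‖w‖ ^ ((p - 2) * (p / 2)) * (‖w‖ ^ p) ^ (1 - p / 2) = 1 := by
    rw [← rpow_mul hn.le, ← rpow_add hn,
      (by ring : (p - 2) * (p / 2) + p * (1 - p / 2) = 0), rpow_zero]
  rw [h3]
  calc _ = |(|v| - t * |u|)| ^ p * (‖w‖ ^ ((p - 2) * (p / 2)) * (‖w‖ ^ p) ^ (1 - p / 2)) := by
        rw [h4, mul_one]
    _ = ‖w‖ ^ ((p - 2) * (p / 2)) * |(|v| - t * |u|)| ^ p * (‖w‖ ^ p) ^ (1 - p / 2) := by ring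
    _ ≤ _ := by gcongr

lemma lintegral_prod_circle_re {α : Type*} [MeasurableSpace α] {μ : Measure α} [SFinite μ]
    {p : ℝ} (hp : 0 < p) {f : α → ℂ} (hf : Measurable f) :
    ∫⁻ z : Circle × α, ENNReal.ofReal (|(z.1 * f z.2).re| ^ p) ∂(Measure.haar.prod μ) =
      (∫⁻ c : Circle, ENNReal.ofReal (|(c : ℂ).re| ^ p) ∂Measure.haar) *
        ∫⁻ x, ENNReal.ofReal (‖f x‖ ^ p) ∂μ := by
  have hcoe : Measurable fun c : Circle => (c : ℂ) :=
    (by fun_prop : Continuous fun c : Circle => (c : ℂ)).measurable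
  rw [lintegral_prod_symm _ (by fun_prop), ← lintegral_const_mul _ (by fun_prop)]
  refine lintegral_congr fun x => ?_
  exact (lintegral_circle_re_mul hp (f x)).trans (mul_comm _ _)

lemma remainder_bound_of_deficit {A B M R : ENNReal} {s δ κ : ℝ}
    (hκ : 0 < κ) (hMA : M * A ≠ ⊤) (h : M * B + ENNReal.ofReal κ * R ≤ ENNReal.ofReal s * (M * A))
    (hlow : ENNReal.ofReal (s - δ) * A ≤ B) : R ≤ ENNReal.ofReal (δ / κ) * (M * A) := by
  have h1 : ENNReal.ofReal s ≤ ENNReal.ofReal (s - δ) + ENNReal.ofReal δ := by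
    refine (ENNReal.ofReal_le_ofReal (by linarith)).trans (ENNReal.ofReal_add_le (p := s - δ))
  have hfin : ENNReal.ofReal (s - δ) * (M * A) ≠ ⊤ := ENNReal.mul_ne_top ENNReal.ofReal_ne_top hMA
  have h2 : ENNReal.ofReal (s - δ) * (M * A) + ENNReal.ofReal κ * R ≤
      ENNReal.ofReal (s - δ) * (M * A) + ENNReal.ofReal δ * (M * A) := by
    rw [← add_mul]
    refine le_trans ?_ (h.trans (mul_le_mul_left h1 (M * A)))
    rw [mul_left_comm]
    gcongr
  have h3 := (ENNReal.add_le_add_iff_left hfin).1 h2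
  rw [div_eq_inv_mul, ENNReal.ofReal_mul (by positivity), ENNReal.ofReal_inv_of_pos hκ, mul_assoc]
  rw [← ENNReal.inv_mul_cancel_left (a := ENNReal.ofReal κ) (b := R) (by simp [hκ])
    ENNReal.ofReal_ne_top]
  gcongr

/-- A rotation-averaged inequality with a quadratic remainder gives stability for near-extremals. -/
lemma lintegral_abs_norm_sub_rpow_le {α : Type*} [MeasurableSpace α] {μ : Measure α} [SFinite μ]
    {p t κ δ : ℝ} (hp1 : 1 < p) (hp2 : p < 2) (ht : 0 ≤ t) (hκ : 0 < κ) (hδ : 0 ≤ δ)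
    {f g : α → ℂ} (hf : Measurable f) (hg : Measurable g)
    (hA : ∫⁻ x, ENNReal.ofReal (‖f x‖ ^ p) ∂μ ≠ ⊤)
    (h : ∀ c : Circle, ∫⁻ x, ENNReal.ofReal (|(c * g x).re| ^ p +
        κ * (‖(⟨(c * f x).re, (c * g x).re⟩ : ℂ)‖ ^ (p - 2) *
          (|(c * g x).re| - t * |(c * f x).re|) ^ 2)) ∂μ ≤
      ∫⁻ x, ENNReal.ofReal (t ^ p * |(c * f x).re| ^ p) ∂μ)
    (hlow : ENNReal.ofReal (t ^ p - δ) * ∫⁻ x, ENNReal.ofReal (‖f x‖ ^ p) ∂μ ≤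
      ∫⁻ x, ENNReal.ofReal (‖g x‖ ^ p) ∂μ) :
    ∫⁻ x, ENNReal.ofReal (|‖g x‖ - t * ‖f x‖| ^ p) ∂μ ≤
      ENNReal.ofReal ((δ / κ) ^ (p / 2) * (1 + t ^ p) ^ (1 - p / 2)) *
        ∫⁻ x, ENNReal.ofReal (‖f x‖ ^ p) ∂μ := by
  have hp0 : 0 < p := by linarith
  have hcoe : Measurable fun c : Circle => (c : ℂ) :=
    (by fun_prop : Continuous fun c : Circle => (c : ℂ)).measurable
  have hU : Measurable fun z : Circle × α => (z.1 * f z.2).re := by fun_prop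
  have hV : Measurable fun z : Circle × α => (z.1 * g z.2).re := by fun_prop
  set U : Circle × α → ℝ := fun z => (z.1 * f z.2).re with hUdef
  set V : Circle × α → ℝ := fun z => (z.1 * g z.2).re with hVdef
  set N : Circle × α → ℝ := fun z => ‖(⟨U z, V z⟩ : ℂ)‖ ^ (p - 2) * (|V z| - t * |U z|) ^ 2
    with hNdef
  have hw : Measurable fun z => (⟨U z, V z⟩ : ℂ) :=
    Complex.measurableEquivRealProd.symm.measurable.comp (hU.prodMk hV)
  have hN : Measurable N := by fun_prop
  have hN0 : ∀ z, 0 ≤ N z := fun z => by positivity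
  set ν := (Measure.haar : Measure Circle).prod μ with hν
  set M := ∫⁻ c : Circle, ENNReal.ofReal (|(c : ℂ).re| ^ p) ∂Measure.haar with hM
  set A := ∫⁻ x, ENNReal.ofReal (‖f x‖ ^ p) ∂μ with hAdef
  set B := ∫⁻ x, ENNReal.ofReal (‖g x‖ ^ p) ∂μ with hBdef
  have hM0 : M ≠ 0 := (lintegral_circle_re_pos hp0).ne'
  have hMtop : M ≠ ⊤ := (lintegral_circle_re_lt_top hp0).ne
  have hUM : ∫⁻ z, ENNReal.ofReal (|U z| ^ p) ∂ν = M * A := lintegral_prod_circle_re hp0 hf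
  have hVM : ∫⁻ z, ENNReal.ofReal (|V z| ^ p) ∂ν = M * B := lintegral_prod_circle_re hp0 hg
  have hinteg : ∫⁻ z, ENNReal.ofReal (|V z| ^ p + κ * N z) ∂ν ≤
      ∫⁻ z, ENNReal.ofReal (t ^ p * |U z| ^ p) ∂ν := by
    rw [hν, lintegral_prod _ (by fun_prop), lintegral_prod _ (by fun_prop)]
    exact lintegral_mono fun c => h c
  have hsum : M * B + ENNReal.ofReal κ * ∫⁻ z, ENNReal.ofReal (N z) ∂ν ≤
      ENNReal.ofReal (t ^ p) * (M * A) := by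
    rw [← hUM, ← hVM, ← lintegral_const_mul _ (by fun_prop), ← lintegral_const_mul _ (by fun_prop),
      ← lintegral_add_left (by fun_prop)]
    refine le_of_eq_of_le (lintegral_congr fun z => ?_)
      (hinteg.trans_eq (lintegral_congr fun z => ?_))
    · rw [ENNReal.ofReal_add (by positivity) (mul_nonneg hκ.le (hN0 z)), ENNReal.ofReal_mul hκ.le]
    · rw [ENNReal.ofReal_mul (by positivity)]
  have hMA : M * A ≠ ⊤ := ENNReal.mul_ne_top hMtop hA
  have hR := remainder_bound_of_deficit hκ hMA hsum hlow
  have hBA : ∫⁻ z, ENNReal.ofReal (|V z| ^ p + |U z| ^ p) ∂ν ≤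
      ENNReal.ofReal (1 + t ^ p) * (M * A) := by
    have : ∀ z, ENNReal.ofReal (|V z| ^ p + |U z| ^ p) =
        ENNReal.ofReal (|V z| ^ p) + ENNReal.ofReal (|U z| ^ p) := fun z =>
      ENNReal.ofReal_add (by positivity) (by positivity)
    simp_rw [this]
    rw [lintegral_add_left (by fun_prop), hUM, hVM, ENNReal.ofReal_add zero_le_one (by positivity),
      add_mul, ENNReal.ofReal_one, one_mul, add_comm]
    exact add_le_add le_rfl (le_self_add.trans hsum)
  have hHolder : ∫⁻ z, ENNReal.ofReal (|(|V z| - t * |U z|)| ^ p) ∂ν ≤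
      (∫⁻ z, ENNReal.ofReal (N z) ∂ν) ^ (p / 2) *
        (∫⁻ z, ENNReal.ofReal (|V z| ^ p + |U z| ^ p) ∂ν) ^ (1 - p / 2) := by
    refine le_trans (lintegral_mono fun z => ?_)
      (ENNReal.lintegral_mul_norm_pow_le (by fun_prop) (by fun_prop) (by linarith) (by linarith)
        (by ring))
    change _ ≤ ENNReal.ofReal (N z) ^ (p / 2) *
      ENNReal.ofReal (|V z| ^ p + |U z| ^ p) ^ (1 - p / 2)
    rw [ENNReal.ofReal_rpow_of_nonneg (hN0 z) (by linarith),
      ENNReal.ofReal_rpow_of_nonneg (by positivity) (by linarith),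
      ← ENNReal.ofReal_mul (rpow_nonneg (hN0 z) _)]
    exact ENNReal.ofReal_le_ofReal (rpow_abs_sub_le hp1 hp2 (U z) (V z))
  have hlower : M * ∫⁻ x, ENNReal.ofReal (|‖g x‖ - t * ‖f x‖| ^ p) ∂μ ≤
      ∫⁻ z, ENNReal.ofReal (|(|V z| - t * |U z|)| ^ p) ∂ν := by
    rw [hν, lintegral_prod_symm _ (by fun_prop), ← lintegral_const_mul _ (by fun_prop)]
    refine lintegral_mono fun x => ?_
    rw [mul_comm]
    exact ofReal_abs_norm_sub_rpow_le hp1.le ht (f x) (g x)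
  rw [← ENNReal.mul_le_mul_iff_right hM0 hMtop]
  calc _ ≤ _ := hlower
    _ ≤ _ := hHolder
    _ ≤ (ENNReal.ofReal (δ / κ) * (M * A)) ^ (p / 2) *
        (ENNReal.ofReal (1 + t ^ p) * (M * A)) ^ (1 - p / 2) := by
      gcongr
      linarith
    _ = ENNReal.ofReal ((δ / κ) ^ (p / 2) * (1 + t ^ p) ^ (1 - p / 2)) *
        ((M * A) ^ (p / 2) * (M * A) ^ (1 - p / 2)) := by
      rw [ENNReal.mul_rpow_of_nonneg _ (M * A) (by linarith),
        ENNReal.mul_rpow_of_nonneg _ (M * A) (by linarith : 0 ≤ 1 - p / 2),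
        ENNReal.ofReal_rpow_of_nonneg (by positivity) (by linarith),
        ENNReal.ofReal_rpow_of_nonneg (by positivity) (by linarith),
        ENNReal.ofReal_mul (by positivity)]
      ring
    _ = _ := by
      rw [← ENNReal.rpow_add_of_nonneg _ _ (by linarith) (by linarith), add_sub_cancel,
        ENNReal.rpow_one]
      ring

lemma measurable_fourierInv {d : ℕ} {h : EuclideanSpace ℝ (Fin d) → ℂ} (hh : Measurable h) :
    Measurable (𝓕⁻ h) := by
  have h1 : 𝓕⁻ h = fun x => ∫ ξ, 𝐞 (inner ℝ ξ x) • h ξ := funext fun x => Real.fourierInv_eq h x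
  rw [h1]
  refine (StronglyMeasurable.integral_prod_right (E := ℂ)
    (f := fun x ξ : EuclideanSpace ℝ (Fin d) => 𝐞 (inner ℝ ξ x) • h ξ) ?_).measurable
  refine Measurable.stronglyMeasurable ?_
  simp only [Function.uncurry_def, Circle.smul_def, smul_eq_mul]
  refine Measurable.mul ?_ (hh.comp measurable_snd)
  exact ((by fun_prop : Continuous fun c : Circle => (c : ℂ)).comp
    (Real.continuous_fourierChar.comp (by fun_prop))).measurable

lemma fourierInv_const_mul {d : ℕ} (c : ℂ) (h : EuclideanSpace ℝ (Fin d) → ℂ)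
    (x : EuclideanSpace ℝ (Fin d)) : 𝓕⁻ (fun ξ => c * h ξ) x = c * 𝓕⁻ h x := by
  rw [Real.fourierInv_eq, Real.fourierInv_eq, ← integral_const_mul]
  refine integral_congr_ae (Filter.Eventually.of_forall fun ξ => ?_)
  simp only [Circle.smul_def, smul_eq_mul]
  ring

lemma ofReal_rpow_sub_le {p t ε : ℝ} (hp : 1 ≤ p) (ht : 0 < t) :
    ENNReal.ofReal (t ^ p - p * t ^ (p - 1) * ε) ≤ ENNReal.ofReal (t - ε) ^ p := by
  have hp0 : 0 ≤ p := by linarith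
  have htp : t ^ p = t ^ (p - 1) * t := by
    rw [← rpow_add_one ht.ne', sub_add_cancel]
  have hpos : 0 < t ^ (p - 1) := rpow_pos_of_pos ht _
  rcases le_total ε t with h | h
  · rw [ENNReal.ofReal_rpow_of_nonneg (by linarith) hp0]
    refine ENNReal.ofReal_le_ofReal ?_
    have hs : -1 ≤ -(ε / t) := by
      rw [neg_le_neg_iff, div_le_one ht]
      exact h
    have h1 := one_add_mul_self_le_rpow_one_add hs hp
    have h2 : t ^ p * (1 + -(ε / t)) ^ p = (t - ε) ^ p := by
      rw [← mul_rpow ht.le (by linarith)]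
      congr 1
      field_simp
      ring
    rw [← h2]
    calc _ = t ^ p * (1 + p * -(ε / t)) := by rw [htp]; field_simp; ring
      _ ≤ _ := by gcongr
  · rw [ENNReal.ofReal_of_nonpos]
    · exact zero_le
    · rw [htp]
      have : t ≤ p * ε := by nlinarith
      nlinarith

lemma stability_const_eq {p c : ℝ} (hp1 : 1 < p) (hp2 : p < 2)
    (hc : c = (32 / π) ^ ((1 : ℝ) / 2) * p ^ ((3 - p) / 2) /
      ((p - 1) ^ ((4 - p) / 2) * (2 - p) ^ ((1 : ℝ) / 2))) :
    c = (32 / π * p ^ (3 - p) / ((p - 1) ^ (4 - p) * (2 - p))) ^ ((1 : ℝ) / 2) := by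
  have hπ := pi_pos
  have hp0 : 0 < p := by linarith
  have hq : 0 < p - 1 := by linarith
  have hr : 0 < 2 - p := by linarith
  rw [hc, div_rpow (x := _ * _) (by positivity) (by positivity),
    mul_rpow (x := 32 / π) (by positivity) (by positivity),
    mul_rpow (by positivity) hr.le, ← rpow_mul hp0.le, ← rpow_mul hq.le]
  ring_nf

/-- The sharp inequality for the Riesz transform, with remainder, along a rotated function. -/
lemma lintegral_rieszTransform_add_remainder_le {d : ℕ} {p θ₀ t : ℝ} (hp1 : 1 < p) (hp2 : p < 2)
    (hθ₀ : θ₀ = π / (2 * p)) (ht : t = tan θ₀) (j : Fin d)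
    (f : SchwartzMap (EuclideanSpace ℝ (Fin d)) ℂ) (c : ℂ) {g : EuclideanSpace ℝ (Fin d) → ℂ}
    (hg : g = 𝓕⁻ (fun ξ : EuclideanSpace ℝ (Fin d) =>
      -Complex.I * (ξ j : ℂ) / (‖ξ‖ : ℂ) * 𝓕 (fun x => f x) ξ)) :
    ∫⁻ x, ENNReal.ofReal (|(c * g x).re| ^ p + (2 - p) / 4 * p ^ 2 / 2 * cos θ₀ ^ 2 *
        (‖(⟨(c * f x).re, (c * g x).re⟩ : ℂ)‖ ^ (p - 2) *
          (|(c * g x).re| - t * |(c * f x).re|) ^ 2)) ≤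
      ∫⁻ x, ENNReal.ofReal (t ^ p * |(c * f x).re| ^ p) := by
  have hπ := pi_pos
  have hp0 : 0 < p := by linarith
  have hpθ₀ : p * θ₀ = π / 2 := by rw [hθ₀]; field_simp
  have hθ₀0 : 0 < θ₀ := by rw [hθ₀]; positivity
  have hθ₀2 : θ₀ < π / 2 := by nlinarith
  have hcos : 0 < cos θ₀ := cos_pos_of_mem_Ioo ⟨by linarith, hθ₀2⟩
  have hsin : 0 < sin θ₀ := sin_pos_of_pos_of_lt_pi hθ₀0 (by linarith)
  have ht0 : 0 < t := by rw [ht]; exact tan_pos_of_pos_of_lt_pi_div_two hθ₀0 hθ₀2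
  have hineq := foldedPow_inequality (k := (2 - p) / 4) hp1 hp2 hθ₀ ht rfl (by linarith)
    (remainder_const_le_sub hp1 hp2 hθ₀ ht) (remainder_const_le_mul hp1 hp2 hθ₀ ht)
  have hk : 0 ≤ (2 - p) / 4 * p ^ 2 / 2 * cos θ₀ ^ 2 := by
    have : 0 ≤ 2 - p := by linarith
    positivity
  set F : SchwartzMap (EuclideanSpace ℝ (Fin d)) ℂ := c • 𝓕 f with hF
  have hFx : ∀ ξ, F ξ = c * 𝓕 (fun x => f x) ξ := fun ξ => rfl
  have hu : (fun x => (c * f x).re) =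
      fun x => (𝓕⁻ (F : EuclideanSpace ℝ (Fin d) → ℂ) x).re := by
    ext x
    have h1 : (F : EuclideanSpace ℝ (Fin d) → ℂ) =
        fun ξ => c * (𝓕 f : SchwartzMap (EuclideanSpace ℝ (Fin d)) ℂ) ξ := rfl
    rw [h1, fourierInv_const_mul, ← SchwartzMap.fourierInv_coe,
      FourierTransform.fourierInv_fourier_eq]
  have hv : (fun x => (c * g x).re) = fun x => (𝓕⁻ (fun ξ : EuclideanSpace ℝ (Fin d) =>
      -Complex.I * (ξ j : ℂ) / (‖ξ‖ : ℂ) * F ξ) x).re := by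
    ext x
    rw [hg, ← fourierInv_const_mul]
    refine congrArg (fun h : EuclideanSpace ℝ (Fin d) → ℂ => (𝓕⁻ h x).re) (funext fun ξ => ?_)
    rw [hFx]
    ring
  refine le_trans (lintegral_mono fun x => ENNReal.ofReal_le_ofReal ?_)
    (lintegral_rieszTransform_le hp1 hp2 (a := t ^ p) (b := sin θ₀ ^ (p - 1) / cos θ₀)
      (by positivity) (by positivity) (fun w => le_trans (by positivity) (hineq w)) j F hu hv)
  exact hineq ⟨(c * f x).re, (c * g x).re⟩

theorem stmt_2 (d : ℕ) (hd : 1 ≤ d) (j : Fin d)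
    (p ε : ℝ) (hp1 : 1 < p) (hp2 : p < 2) (hε : 0 < ε)
    (c : ℝ)
    (hc : c = (32 / π) ^ ((1 : ℝ) / 2) * p ^ ((3 - p) / 2) /
        ((p - 1) ^ ((4 - p) / 2) * (2 - p) ^ ((1 : ℝ) / 2)))
    (f : SchwartzMap (EuclideanSpace ℝ (Fin d)) ℂ)
    (Rf : EuclideanSpace ℝ (Fin d) → ℂ)
    (hRf : Rf = 𝓕⁻ (fun ξ : EuclideanSpace ℝ (Fin d) =>
        -Complex.I * (ξ j : ℂ) / (‖ξ‖ : ℂ) * 𝓕 (fun x => f x) ξ))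
    (hlow : ENNReal.ofReal (Real.tan (π / (2 * p)) - ε) *
          eLpNorm (fun x => f x) (ENNReal.ofReal p) volume ≤
        eLpNorm Rf (ENNReal.ofReal p) volume) :
    eLpNorm (fun x => ‖Rf x‖ - Real.tan (π / (2 * p)) * ‖f x‖)
        (ENNReal.ofReal p) volume ≤
      ENNReal.ofReal (c * ε ^ ((1 : ℝ) / 2)) *
        eLpNorm (fun x => f x) (ENNReal.ofReal p) volume := by
  have hπ := pi_pos
  have hp0 : 0 < p := by linarith
  set θ₀ := π / (2 * p) with hθ₀
  set t := tan θ₀ with ht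
  have hpθ₀ : p * θ₀ = π / 2 := by rw [hθ₀]; field_simp
  have hθ₀0 : 0 < θ₀ := by rw [hθ₀]; positivity
  have hθ₀2 : θ₀ < π / 2 := by nlinarith
  have hcos : 0 < cos θ₀ := cos_pos_of_mem_Ioo ⟨by linarith, hθ₀2⟩
  have ht0 : 0 < t := tan_pos_of_pos_of_lt_pi_div_two hθ₀0 hθ₀2
  have hr : 0 < 2 - p := by linarith
  set κ := (2 - p) / 4 * p ^ 2 / 2 * cos θ₀ ^ 2 with hκ
  have hκ0 : 0 < κ := by positivity
  have hRm : Measurable Rf := by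
    rw [hRf]
    have : Measurable (𝓕 (fun x => f x)) :=
      (𝓕 f : SchwartzMap (EuclideanSpace ℝ (Fin d)) ℂ).continuous.measurable
    exact measurable_fourierInv (by fun_prop)
  have hA : ∫⁻ x, ENNReal.ofReal (‖f x‖ ^ p) ≠ ⊤ := by
    have h1 := (f.memLp (ENNReal.ofReal p) volume).2
    rw [eLpNorm_ofReal_eq hp0] at h1
    exact ((ENNReal.rpow_lt_top_iff_of_pos (by positivity)).1 h1).ne
  simp only [eLpNorm_ofReal_eq hp0] at hlow ⊢
  have hlow' := ENNReal.rpow_le_rpow hlow hp0.le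
  rw [ENNReal.mul_rpow_of_nonneg _ _ hp0.le, ← ENNReal.rpow_mul, ← ENNReal.rpow_mul,
    one_div_mul_cancel hp0.ne', ENNReal.rpow_one, ENNReal.rpow_one] at hlow'
  have hmain := lintegral_abs_norm_sub_rpow_le (δ := p * t ^ (p - 1) * ε) hp1 hp2 ht0.le hκ0
    (by positivity) f.continuous.measurable hRm hA
    (fun z => lintegral_rieszTransform_add_remainder_le hp1 hp2 hθ₀ ht j f z hRf)
    (le_trans (by gcongr; exact ofReal_rpow_sub_le hp1.le ht0) hlow')
  have hδκ : p * t ^ (p - 1) * ε / κ =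
      ε * (2 * (1 + t ^ 2) * t ^ (p - 1) / ((2 - p) / 4 * p)) := by
    rw [hκ, ← inv_one_add_tan_sq hcos.ne', ← ht]
    field_simp
  have hconst : ((p * t ^ (p - 1) * ε / κ) ^ (p / 2) * (1 + t ^ p) ^ (1 - p / 2)) ^ (1 / p) ≤
      c * ε ^ ((1 : ℝ) / 2) := by
    have h1 : ((p * t ^ (p - 1) * ε / κ) ^ (p / 2) * (1 + t ^ p) ^ (1 - p / 2)) ^ (1 / p) =
        (ε * (2 * (1 + t ^ 2) * t ^ (p - 1) * (1 + t ^ p) ^ ((2 - p) / p) /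
          ((2 - p) / 4 * p))) ^ ((1 : ℝ) / 2) := by
      have h2 : ε * (2 * (1 + t ^ 2) * t ^ (p - 1) * (1 + t ^ p) ^ ((2 - p) / p) /
          ((2 - p) / 4 * p)) = p * t ^ (p - 1) * ε / κ * (1 + t ^ p) ^ ((2 - p) / p) := by
        rw [hδκ]
        ring
      rw [h2, mul_rpow (by positivity) (by positivity), mul_rpow (by positivity) (by positivity),
        ← rpow_mul (by positivity), ← rpow_mul (by positivity), ← rpow_mul (by positivity)]
      congr 2 <;> field_simp
    rw [h1, stability_const_eq hp1 hp2 hc, mul_comm _ (ε ^ _), mul_rpow hε.le (by positivity)]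
    exact mul_le_mul_of_nonneg_left (rpow_le_rpow (by positivity)
      (stability_const_bound hp1 hp2 ht) (by norm_num)) (by positivity)
  have hfinal := ENNReal.rpow_le_rpow hmain (by positivity : 0 ≤ 1 / p)
  rw [ENNReal.mul_rpow_of_nonneg _ _ (by positivity),
    ENNReal.ofReal_rpow_of_nonneg (by positivity) (by positivity)] at hfinal
  refine hfinal.trans ?_
  gcongr
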